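/- arXiv:2210.16531 — 2 statements merged into one kernel-verified Lean document; each statement's English description precedes it below -/
import Mathlib

section
/- Let N ≥ 2, s ∈ (0,1), γ ∈ [(2s-N)/2, 2s), and 0 < h < 1/4. With η_h as the logarithmic cut-off (η_h = 0 on B_{h²}(0), η_h = 1 outside B_h(0), η_h(x) = 1 - ln(|x|/h)/ln h in between), there exists a constant c = c(N, s, γ), independent of h, such that ∫_{|x|≤2h} ∫_{|y|≤2h} |η_h(x) - η_h(y)|² |x-y|^{-(N+2s)} |y|^γ |x|^γ dy dx ≤ c |ln h|^{-1} for all sufficiently small h. -/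
open MeasureTheory

section RadialPowers

variable {E : Type*} [NormedAddCommGroup E] [NormedSpace ℝ E] [FiniteDimensional ℝ E]
  [Nontrivial E] [MeasurableSpace E] [BorelSpace E] (μ : Measure E) [μ.IsAddHaarMeasure]

/-- Polar coordinates for the integral of a power of the norm over a radial set. -/
lemma setLIntegral_norm_rpow (p : ℝ) {T : Set ℝ} (hT : MeasurableSet T)
    (hint : IntegrableOn (fun r : ℝ => r ^ (Module.finrank ℝ E - 1 + p)) (T ∩ Set.Ioi 0)) :
    ∫⁻ x in {x : E | ‖x‖ ∈ T}, ENNReal.ofReal (‖x‖ ^ p) ∂μ =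
      ENNReal.ofReal (Module.finrank ℝ E * μ.real (Metric.ball 0 1) *
        ∫ r in T ∩ Set.Ioi 0, r ^ (Module.finrank ℝ E - 1 + p)) := by
  have hTE : MeasurableSet {x : E | ‖x‖ ∈ T} := measurable_norm hT
  have hd : 1 ≤ Module.finrank ℝ E := Module.finrank_pos
  have key : ∀ r ∈ Set.Ioi (0 : ℝ),
      r ^ (Module.finrank ℝ E - 1) • T.indicator (fun r : ℝ => r ^ p) r =
        T.indicator (fun r : ℝ => r ^ (Module.finrank ℝ E - 1 + p)) r := by
    intro r hr
    by_cases h : r ∈ T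
    · rw [Set.indicator_of_mem h, Set.indicator_of_mem h, Real.rpow_add hr, smul_eq_mul,
        ← Nat.cast_pred hd, Real.rpow_natCast]
    · simp [Set.indicator_of_notMem h]
  have hind : ∀ x : E, T.indicator (fun r : ℝ => r ^ p) ‖x‖ =
      {x : E | ‖x‖ ∈ T}.indicator (fun x : E => ‖x‖ ^ p) x := fun x => rfl
  have hI : Integrable (fun x : E => T.indicator (fun r : ℝ => r ^ p) ‖x‖) μ := by
    rw [integrable_fun_norm_addHaar μ, integrableOn_congr_fun key measurableSet_Ioi,
      integrableOn_indicator_iff hT]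
    exact hint
  have hI' : IntegrableOn (fun x : E => ‖x‖ ^ p) {x : E | ‖x‖ ∈ T} μ := by
    rw [← integrable_indicator_iff hTE]
    exact hI
  rw [← ofReal_integral_eq_lintegral_ofReal hI' (ae_of_all _ fun x => by positivity),
    ← integral_indicator hTE]
  have h2 := integral_fun_norm_addHaar μ (T.indicator (fun r : ℝ => r ^ p))
  rw [setIntegral_congr_fun measurableSet_Ioi key, setIntegral_indicator hT, Set.inter_comm] at h2
  simp only [hind] at h2
  rw [h2, nsmul_eq_mul, smul_eq_mul, mul_assoc]

/-- Integral of a locally integrable power of the norm over a ball. -/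
lemma exists_setLIntegral_norm_rpow_Iic_le {p : ℝ} (hp : -(Module.finrank ℝ E : ℝ) < p) :
    ∃ C > 0, ∀ R > 0, ∫⁻ x in {x : E | ‖x‖ ∈ Set.Iic R}, ENNReal.ofReal (‖x‖ ^ p) ∂μ ≤
      ENNReal.ofReal (C * R ^ (Module.finrank ℝ E + p)) := by
  have hd : 0 < Module.finrank ℝ E := Module.finrank_pos
  have hb : 0 < μ.real (Metric.ball (0 : E) 1) :=
    ENNReal.toReal_pos (Metric.measure_ball_pos μ _ one_pos).ne' measure_ball_lt_top.ne
  have hdp : 0 < Module.finrank ℝ E + p := by linarith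
  refine ⟨Module.finrank ℝ E * μ.real (Metric.ball (0 : E) 1) / (Module.finrank ℝ E + p),
    by positivity, fun R hR => ?_⟩
  have hset : Set.Iic R ∩ Set.Ioi 0 = Set.Ioc 0 R := by rw [Set.inter_comm, Set.Ioi_inter_Iic]
  have hq : -1 < (Module.finrank ℝ E : ℝ) - 1 + p := by linarith
  rw [setLIntegral_norm_rpow μ p measurableSet_Iic, hset,
    ← intervalIntegral.integral_of_le hR.le, integral_rpow (Or.inl hq)]
  · apply ENNReal.ofReal_le_ofReal
    have : (Module.finrank ℝ E : ℝ) - 1 + p + 1 = Module.finrank ℝ E + p := by ring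
    rw [this, Real.zero_rpow hdp.ne', sub_zero]
    apply le_of_eq
    ring
  · rw [hset, ← intervalIntegrable_iff_integrableOn_Ioc_of_le hR.le]
    exact intervalIntegral.intervalIntegrable_rpow' hq

/-- Integral of a decaying power of the norm over the exterior of a ball. -/
lemma exists_setLIntegral_norm_rpow_Ioi_le {p : ℝ} (hp : p < -(Module.finrank ℝ E : ℝ)) :
    ∃ C > 0, ∀ R > 0, ∫⁻ x in {x : E | ‖x‖ ∈ Set.Ioi R}, ENNReal.ofReal (‖x‖ ^ p) ∂μ ≤
      ENNReal.ofReal (C * R ^ (Module.finrank ℝ E + p)) := by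
  have hd : 0 < Module.finrank ℝ E := Module.finrank_pos
  have hb : 0 < μ.real (Metric.ball (0 : E) 1) :=
    ENNReal.toReal_pos (Metric.measure_ball_pos μ _ one_pos).ne' measure_ball_lt_top.ne
  have hdp : 0 < -(Module.finrank ℝ E + p) := by linarith
  refine ⟨Module.finrank ℝ E * μ.real (Metric.ball (0 : E) 1) / -(Module.finrank ℝ E + p),
    by positivity, fun R hR => ?_⟩
  have hset : Set.Ioi R ∩ Set.Ioi 0 = Set.Ioi R := by
    rw [Set.Ioi_inter_Ioi, sup_eq_left.2 hR.le]
  have hq : (Module.finrank ℝ E : ℝ) - 1 + p < -1 := by linarith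
  rw [setLIntegral_norm_rpow μ p measurableSet_Ioi, hset, integral_Ioi_rpow_of_lt hq hR]
  · apply ENNReal.ofReal_le_ofReal
    have : (Module.finrank ℝ E : ℝ) - 1 + p + 1 = Module.finrank ℝ E + p := by ring
    rw [this]
    apply le_of_eq
    rw [div_neg, neg_div]
    ring
  · rw [hset]
    exact integrableOn_Ioi_rpow_of_lt hq hR

/-- The critical power of the norm has logarithmic mass on annuli. -/
lemma exists_setLIntegral_norm_rpow_Icc_le :
    ∃ C > 0, ∀ r > 0, ∀ R ≥ r, ∫⁻ x in {x : E | ‖x‖ ∈ Set.Icc r R},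
      ENNReal.ofReal (‖x‖ ^ (-(Module.finrank ℝ E : ℝ))) ∂μ ≤
        ENNReal.ofReal (C * Real.log (R / r)) := by
  have hd : 0 < Module.finrank ℝ E := Module.finrank_pos
  have hb : 0 < μ.real (Metric.ball (0 : E) 1) :=
    ENNReal.toReal_pos (Metric.measure_ball_pos μ _ one_pos).ne' measure_ball_lt_top.ne
  refine ⟨Module.finrank ℝ E * μ.real (Metric.ball (0 : E) 1), by positivity,
    fun r hr R hR => ?_⟩
  have hset : Set.Icc r R ∩ Set.Ioi 0 = Set.Icc r R :=
    Set.inter_eq_left.2 fun t ht => hr.trans_le ht.1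
  have he : (Module.finrank ℝ E : ℝ) - 1 + -(Module.finrank ℝ E : ℝ) = -1 := by ring
  rw [setLIntegral_norm_rpow μ _ measurableSet_Icc, hset, he, integral_Icc_eq_integral_Ioc,
    ← intervalIntegral.integral_of_le hR]
  · simp only [Real.rpow_neg_one]
    rw [integral_inv_of_pos hr (hr.trans_le hR)]
  · rw [hset, he]
    refine ContinuousOn.integrableOn_Icc fun t ht => ?_
    exact (Real.continuousAt_rpow_const _ _ (Or.inl (hr.trans_le ht.1).ne')).continuousWithinAt

end RadialPowers

/-- The squared logarithm grows slower than any positive power. -/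
lemma sq_log_sub_log_le {δ r t : ℝ} (hδ : 0 < δ) (ht : 0 < t) (hr : t ≤ r) :
    (Real.log r - Real.log t) ^ 2 ≤ r ^ (2 * δ) * t ^ (-(2 * δ)) / δ ^ 2 := by
  have hr0 : 0 < r := ht.trans_le hr
  have h1 := Real.log_le_rpow_div (x := r / t) (by positivity) hδ
  have h0 : 0 ≤ Real.log (r / t) := Real.log_nonneg ((one_le_div ht).2 hr)
  rw [← Real.log_div hr0.ne' ht.ne']
  calc Real.log (r / t) ^ 2 ≤ ((r / t) ^ δ / δ) ^ 2 := by gcongr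
    _ = _ := by
      rw [div_pow, ← Real.rpow_natCast ((r / t) ^ δ), ← Real.rpow_mul (by positivity),
        Real.div_rpow hr0.le ht.le, Real.rpow_neg ht.le]
      push_cast
      rw [mul_comm δ 2]
      field_simp

lemma abs_log_sub_log_le {m r t : ℝ} (hm : 0 < m) (hr : m ≤ r) (ht : m ≤ t) :
    |Real.log r - Real.log t| ≤ |r - t| / m := by
  wlog h : t ≤ r generalizing r t
  · rw [abs_sub_comm, abs_sub_comm r]
    exact this ht hr (le_of_not_ge h)
  have ht0 : 0 < t := hm.trans_le ht
  have hr0 : 0 < r := hm.trans_le hr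
  rw [abs_of_nonneg (sub_nonneg.2 (Real.log_le_log ht0 h)), abs_of_nonneg (sub_nonneg.2 h),
    ← Real.log_div hr0.ne' ht0.ne']
  calc Real.log (r / t) ≤ r / t - 1 := Real.log_le_sub_one_of_pos (by positivity)
    _ = (r - t) / t := by field_simp
    _ ≤ (r - t) / m := by
      have := sub_nonneg.2 h
      gcongr

lemma rpow_le_two_rpow_abs_mul {r t : ℝ} (γ : ℝ) (hr : 0 < r) (h1 : r / 2 ≤ t) (h2 : t ≤ 2 * r) :
    t ^ γ ≤ 2 ^ |γ| * r ^ γ := by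
  have ht : 0 < t := by linarith
  rcases le_total 0 γ with h | h
  · rw [abs_of_nonneg h, ← Real.mul_rpow (by norm_num) hr.le]
    gcongr
  · rw [abs_of_nonpos h, Real.rpow_neg (by norm_num), ← Real.inv_rpow (by norm_num),
      ← Real.mul_rpow (by norm_num) hr.le]
    exact Real.rpow_le_rpow_of_nonpos (by positivity) (by linarith) h

section LogKernel

variable {E : Type*} [NormedAddCommGroup E] [NormedSpace ℝ E] [FiniteDimensional ℝ E]
  [Nontrivial E] [MeasurableSpace E] [BorelSpace E] (μ : Measure E) [μ.IsAddHaarMeasure]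

/-- Contribution of `‖y‖ ≤ ‖x‖ / 2`. -/
lemma exists_setLIntegral_log_kernel_inner_le {s γ δ : ℝ} (hs : 0 < s) (hδ : 0 < δ)
    (hγ : -(Module.finrank ℝ E : ℝ) < γ - 2 * δ) :
    ∃ C > 0, ∀ x : E, x ≠ 0 → ∫⁻ y in {y : E | ‖y‖ ∈ Set.Iic (‖x‖ / 2)},
      ENNReal.ofReal ((Real.log ‖x‖ - Real.log ‖y‖) ^ 2 *
        ‖x - y‖ ^ (-(Module.finrank ℝ E + 2 * s)) * ‖y‖ ^ γ) ∂μ ≤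
      ENNReal.ofReal (C * ‖x‖ ^ (γ - 2 * s)) := by
  obtain ⟨C, hC, hb⟩ := exists_setLIntegral_norm_rpow_Iic_le μ hγ
  set d : ℝ := ((Module.finrank ℝ E : ℕ) : ℝ) with hd
  have hd0 : 0 ≤ d := Nat.cast_nonneg _
  refine ⟨(1 / 2) ^ (-(d + 2 * s)) / δ ^ 2 * (C * (1 / 2) ^ (d + (γ - 2 * δ))), by positivity,
    fun x hx => ?_⟩
  have hr : 0 < ‖x‖ := norm_pos_iff.2 hx
  have hr2 : ‖x‖ / 2 = 1 / 2 * ‖x‖ := by ring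
  calc _ ≤ ∫⁻ y in {y : E | ‖y‖ ∈ Set.Iic (‖x‖ / 2)}, ENNReal.ofReal
        ((‖x‖ / 2) ^ (-(d + 2 * s)) * ‖x‖ ^ (2 * δ) / δ ^ 2) *
          ENNReal.ofReal (‖y‖ ^ (γ - 2 * δ)) ∂μ := by
        refine lintegral_mono_ae ?_
        filter_upwards [ae_restrict_mem (measurable_norm measurableSet_Iic),
          ae_restrict_of_ae (Measure.ae_ne μ 0)] with y hy hy0
        have ht : 0 < ‖y‖ := norm_pos_iff.2 hy0
        have hy' : ‖y‖ ≤ ‖x‖ / 2 := hy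
        rw [← ENNReal.ofReal_mul (by positivity)]
        apply ENNReal.ofReal_le_ofReal
        have hu : ‖x‖ / 2 ≤ ‖x - y‖ := by linarith [norm_sub_norm_le x y]
        have h1 := sq_log_sub_log_le hδ ht (show ‖y‖ ≤ ‖x‖ by linarith)
        have h2 : ‖x - y‖ ^ (-(d + 2 * s)) ≤ (‖x‖ / 2) ^ (-(d + 2 * s)) :=
          Real.rpow_le_rpow_of_nonpos (by positivity) hu (by linarith)
        calc _ ≤ (‖x‖ ^ (2 * δ) * ‖y‖ ^ (-(2 * δ)) / δ ^ 2) * (‖x‖ / 2) ^ (-(d + 2 * s)) *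
              ‖y‖ ^ γ := by gcongr
          _ = _ := by
            rw [sub_eq_add_neg γ, Real.rpow_add ht]
            ring
    _ ≤ ENNReal.ofReal ((‖x‖ / 2) ^ (-(d + 2 * s)) * ‖x‖ ^ (2 * δ) / δ ^ 2) *
          ENNReal.ofReal (C * (‖x‖ / 2) ^ (d + (γ - 2 * δ))) := by
        rw [lintegral_const_mul' _ _ ENNReal.ofReal_ne_top]
        gcongr
        exact hb _ (by positivity)
    _ = _ := by
        rw [← ENNReal.ofReal_mul (by positivity), hr2, Real.mul_rpow (by norm_num) hr.le,
          Real.mul_rpow (by norm_num) hr.le,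
          show γ - 2 * s = -(d + 2 * s) + 2 * δ + (d + (γ - 2 * δ)) by ring,
          Real.rpow_add hr _ (d + (γ - 2 * δ)), Real.rpow_add hr _ (2 * δ)]
        congr 1
        ring

/-- Contribution of `‖y‖ > 2 * ‖x‖`. -/
lemma exists_setLIntegral_log_kernel_outer_le {s γ δ : ℝ} (hs : 0 < s) (hδ : 0 < δ)
    (hγ : γ + 2 * δ < 2 * s) :
    ∃ C > 0, ∀ x : E, x ≠ 0 → ∫⁻ y in {y : E | ‖y‖ ∈ Set.Ioi (2 * ‖x‖)},
      ENNReal.ofReal ((Real.log ‖x‖ - Real.log ‖y‖) ^ 2 *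
        ‖x - y‖ ^ (-(Module.finrank ℝ E + 2 * s)) * ‖y‖ ^ γ) ∂μ ≤
      ENNReal.ofReal (C * ‖x‖ ^ (γ - 2 * s)) := by
  obtain ⟨C, hC, hb⟩ := exists_setLIntegral_norm_rpow_Ioi_le μ
    (p := 2 * δ + -(Module.finrank ℝ E + 2 * s) + γ) (by linarith)
  set d : ℝ := ((Module.finrank ℝ E : ℕ) : ℝ) with hd
  have hd0 : 0 ≤ d := Nat.cast_nonneg _
  refine ⟨(1 / 2) ^ (-(d + 2 * s)) / δ ^ 2 * (C * 2 ^ (d + (2 * δ + -(d + 2 * s) + γ))),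
    by positivity, fun x hx => ?_⟩
  have hr : 0 < ‖x‖ := norm_pos_iff.2 hx
  calc _ ≤ ∫⁻ y in {y : E | ‖y‖ ∈ Set.Ioi (2 * ‖x‖)}, ENNReal.ofReal
        ((1 / 2) ^ (-(d + 2 * s)) * ‖x‖ ^ (-(2 * δ)) / δ ^ 2) *
          ENNReal.ofReal (‖y‖ ^ (2 * δ + -(d + 2 * s) + γ)) ∂μ := by
        refine lintegral_mono_ae ?_
        filter_upwards [ae_restrict_mem (measurable_norm measurableSet_Ioi)] with y hy
        have hy' : 2 * ‖x‖ < ‖y‖ := hy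
        have ht : 0 < ‖y‖ := by linarith
        rw [← ENNReal.ofReal_mul (by positivity)]
        apply ENNReal.ofReal_le_ofReal
        have hu : 1 / 2 * ‖y‖ ≤ ‖x - y‖ := by linarith [norm_sub_norm_le y x, norm_sub_rev x y]
        have h1 := sq_log_sub_log_le hδ hr (show ‖x‖ ≤ ‖y‖ by linarith)
        have h2 : ‖x - y‖ ^ (-(d + 2 * s)) ≤ (1 / 2 * ‖y‖) ^ (-(d + 2 * s)) :=
          Real.rpow_le_rpow_of_nonpos (by positivity) hu (by linarith)
        rw [← neg_sub (Real.log ‖y‖), neg_sq]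
        calc _ ≤ (‖y‖ ^ (2 * δ) * ‖x‖ ^ (-(2 * δ)) / δ ^ 2) * (1 / 2 * ‖y‖) ^ (-(d + 2 * s)) *
              ‖y‖ ^ γ := by gcongr
          _ = _ := by
            rw [Real.mul_rpow (by norm_num) ht.le, Real.rpow_add ht, Real.rpow_add ht]
            ring
    _ ≤ ENNReal.ofReal ((1 / 2) ^ (-(d + 2 * s)) * ‖x‖ ^ (-(2 * δ)) / δ ^ 2) *
          ENNReal.ofReal (C * (2 * ‖x‖) ^ (d + (2 * δ + -(d + 2 * s) + γ))) := by
        rw [lintegral_const_mul' _ _ ENNReal.ofReal_ne_top]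
        gcongr
        exact hb _ (by positivity)
    _ = _ := by
        rw [← ENNReal.ofReal_mul (by positivity), Real.mul_rpow (by norm_num) hr.le,
          show γ - 2 * s = -(2 * δ) + (d + (2 * δ + -(d + 2 * s) + γ)) by ring,
          Real.rpow_add hr (-(2 * δ))]
        congr 1
        ring

/-- Contribution of `‖x‖ / 2 < ‖y‖ ≤ 2 * ‖x‖`, which contains the diagonal singularity. -/
lemma exists_setLIntegral_log_kernel_middle_le {s : ℝ} (γ : ℝ) (hs : s < 1) :
    ∃ C > 0, ∀ x : E, x ≠ 0 → ∫⁻ y in {y : E | ‖y‖ ∈ Set.Ioc (‖x‖ / 2) (2 * ‖x‖)},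
      ENNReal.ofReal ((Real.log ‖x‖ - Real.log ‖y‖) ^ 2 *
        ‖x - y‖ ^ (-(Module.finrank ℝ E + 2 * s)) * ‖y‖ ^ γ) ∂μ ≤
      ENNReal.ofReal (C * ‖x‖ ^ (γ - 2 * s)) := by
  obtain ⟨C, hC, hb⟩ := exists_setLIntegral_norm_rpow_Iic_le μ
    (p := 2 + -(Module.finrank ℝ E + 2 * s)) (by linarith)
  set d : ℝ := ((Module.finrank ℝ E : ℕ) : ℝ) with hd
  refine ⟨4 * 2 ^ |γ| * (C * 3 ^ (d + (2 + -(d + 2 * s)))), by positivity, fun x hx => ?_⟩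
  have hr : 0 < ‖x‖ := norm_pos_iff.2 hx
  have hA : MeasurableSet {y : E | ‖y‖ ∈ Set.Ioc (‖x‖ / 2) (2 * ‖x‖)} :=
    measurable_norm measurableSet_Ioc
  have hB : MeasurableSet {y : E | ‖y‖ ∈ Set.Iic (3 * ‖x‖)} := measurable_norm measurableSet_Iic
  set f : E → ENNReal := {z : E | ‖z‖ ∈ Set.Iic (3 * ‖x‖)}.indicator
    fun z => ENNReal.ofReal (‖z‖ ^ (2 + -(d + 2 * s))) with hf
  have hpt : ∀ y ∈ {y : E | ‖y‖ ∈ Set.Ioc (‖x‖ / 2) (2 * ‖x‖)},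
      ENNReal.ofReal ((Real.log ‖x‖ - Real.log ‖y‖) ^ 2 *
        ‖x - y‖ ^ (-(d + 2 * s)) * ‖y‖ ^ γ) ≤
      ENNReal.ofReal (4 * 2 ^ |γ| * ‖x‖ ^ (γ - 2)) * f (x - y) := by
    rintro y ⟨hy1, hy2⟩
    have hmem : x - y ∈ {z : E | ‖z‖ ∈ Set.Iic (3 * ‖x‖)} := by
      change ‖x - y‖ ≤ 3 * ‖x‖
      linarith [norm_sub_le x y]
    rw [hf, Set.indicator_of_mem hmem, ← ENNReal.ofReal_mul (by positivity)]
    apply ENNReal.ofReal_le_ofReal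
    rcases (norm_nonneg (x - y)).eq_or_lt with h0 | hu
    · have : x = y := by rwa [eq_comm, norm_eq_zero, sub_eq_zero] at h0
      rw [← this, sub_self, zero_pow two_ne_zero, zero_mul, zero_mul]
      positivity
    have h1 : (Real.log ‖x‖ - Real.log ‖y‖) ^ 2 ≤ (‖x - y‖ / (‖x‖ / 2)) ^ 2 := by
      rw [← sq_abs]
      gcongr
      refine (abs_log_sub_log_le (half_pos hr) (half_le_self hr.le) hy1.le).trans ?_
      gcongr
      exact abs_norm_sub_norm_le x y
    have h2 := rpow_le_two_rpow_abs_mul γ hr hy1.le hy2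
    calc _ ≤ (‖x - y‖ / (‖x‖ / 2)) ^ 2 * ‖x - y‖ ^ (-(d + 2 * s)) * (2 ^ |γ| * ‖x‖ ^ γ) := by
          gcongr
      _ = _ := by
        rw [Real.rpow_add hu, Real.rpow_sub hr, Real.rpow_two, Real.rpow_two]
        field_simp
        ring
  calc _ ≤ ∫⁻ y in {y : E | ‖y‖ ∈ Set.Ioc (‖x‖ / 2) (2 * ‖x‖)},
        ENNReal.ofReal (4 * 2 ^ |γ| * ‖x‖ ^ (γ - 2)) * f (x - y) ∂μ :=
        setLIntegral_mono' hA hpt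
    _ ≤ ∫⁻ y, ENNReal.ofReal (4 * 2 ^ |γ| * ‖x‖ ^ (γ - 2)) * f (x - y) ∂μ :=
        setLIntegral_le_lintegral _ _
    _ ≤ ENNReal.ofReal (4 * 2 ^ |γ| * ‖x‖ ^ (γ - 2)) *
          ENNReal.ofReal (C * (3 * ‖x‖) ^ (d + (2 + -(d + 2 * s)))) := by
        rw [lintegral_const_mul' _ _ ENNReal.ofReal_ne_top, lintegral_sub_left_eq_self f x, hf,
          lintegral_indicator hB]
        gcongr
        exact hb _ (by positivity)
    _ = _ := by
        rw [← ENNReal.ofReal_mul (by positivity), Real.mul_rpow (by norm_num) hr.le,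
          show γ - 2 * s = (γ - 2) + (d + (2 + -(d + 2 * s))) by ring,
          Real.rpow_add hr (γ - 2)]
        congr 1
        ring

/-- The weighted Gagliardo density of the logarithm of the norm scales like `‖x‖ ^ (γ - 2 * s)`. -/
lemma exists_lintegral_log_kernel_le {s γ : ℝ} (hs0 : 0 < s) (hs1 : s < 1)
    (hγ0 : -(Module.finrank ℝ E : ℝ) < γ) (hγ1 : γ < 2 * s) :
    ∃ C > 0, ∀ x : E, x ≠ 0 → ∫⁻ y,
      ENNReal.ofReal ((Real.log ‖x‖ - Real.log ‖y‖) ^ 2 *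
        ‖x - y‖ ^ (-(Module.finrank ℝ E + 2 * s)) * ‖y‖ ^ γ) ∂μ ≤
      ENNReal.ofReal (C * ‖x‖ ^ (γ - 2 * s)) := by
  set δ : ℝ := min (Module.finrank ℝ E + γ) (2 * s - γ) / 4 with hδ
  have hm : 0 < min (Module.finrank ℝ E + γ) (2 * s - γ) := lt_min (by linarith) (by linarith)
  have hm1 := min_le_left (Module.finrank ℝ E + γ) (2 * s - γ)
  have hm2 := min_le_right (Module.finrank ℝ E + γ) (2 * s - γ)
  obtain ⟨A, hA, hA'⟩ := exists_setLIntegral_log_kernel_inner_le μ (s := s) (γ := γ) (δ := δ)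
    hs0 (by positivity) (by linarith)
  obtain ⟨B, hB, hB'⟩ := exists_setLIntegral_log_kernel_outer_le μ (s := s) (γ := γ) (δ := δ)
    hs0 (by positivity) (by linarith)
  obtain ⟨D, hD, hD'⟩ := exists_setLIntegral_log_kernel_middle_le μ γ hs1
  refine ⟨A + (D + B), by positivity, fun x hx => ?_⟩
  have hcover : {y : E | ‖y‖ ∈ Set.Iic (‖x‖ / 2)} ∪ ({y : E | ‖y‖ ∈ Set.Ioc (‖x‖ / 2) (2 * ‖x‖)} ∪
      {y : E | ‖y‖ ∈ Set.Ioi (2 * ‖x‖)}) = Set.univ := by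
    refine Set.eq_univ_of_forall fun y => ?_
    rcases le_or_gt ‖y‖ (‖x‖ / 2) with h | h
    · exact Or.inl h
    rcases le_or_gt ‖y‖ (2 * ‖x‖) with h' | h'
    · exact Or.inr (Or.inl ⟨h, h'⟩)
    · exact Or.inr (Or.inr h')
  rw [← setLIntegral_univ, ← hcover, add_mul, add_mul, ENNReal.ofReal_add (by positivity)
    (by positivity), ENNReal.ofReal_add (by positivity) (by positivity)]
  exact (lintegral_union_le _ _ _).trans (add_le_add (hA' x hx)
    ((lintegral_union_le _ _ _).trans (add_le_add (hD' x hx) (hB' x hx))))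

end LogKernel

/-- Radial profile of the logarithmic cut-off. -/
noncomputable def logCutoff (h r : ℝ) : ℝ :=
  if h < r then 1 else if h ^ 2 ≤ r then 1 - Real.log (r / h) / Real.log h else 0

lemma logCutoff_of_lt {h r : ℝ} (h0 : 0 < h) (h1 : h < 1) (hr : r < h ^ 2) :
    logCutoff h r = 0 := by
  have : h ^ 2 ≤ h := by nlinarith
  rw [logCutoff, if_neg (by linarith), if_neg (by linarith)]

lemma measurable_logCutoff (h : ℝ) : Measurable (logCutoff h) := by
  unfold logCutoff
  refine Measurable.ite measurableSet_Ioi measurable_const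
    (Measurable.ite measurableSet_Ici ?_ measurable_const)
  fun_prop

lemma logCutoff_eq_max_min {h r : ℝ} (h0 : 0 < h) (h1 : h < 1) (hr : 0 < r) :
    logCutoff h r = max (min (2 - Real.log r / Real.log h) 1) 0 := by
  have hl : Real.log h < 0 := Real.log_neg h0 h1
  unfold logCutoff
  split_ifs with h2 h3
  · have : Real.log r / Real.log h ≤ 1 := by
      rw [div_le_one_of_neg hl]
      exact Real.log_le_log h0 h2.le
    rw [min_eq_right (by linarith), max_eq_left zero_le_one]
  · have e1 : 1 ≤ Real.log r / Real.log h := by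
      rw [one_le_div_of_neg hl]
      exact Real.log_le_log hr (not_lt.1 h2)
    have e2 : Real.log r / Real.log h ≤ 2 := by
      rw [div_le_iff_of_neg hl]
      have := Real.log_le_log (by positivity) h3
      rw [Real.log_pow] at this
      exact_mod_cast this
    rw [min_eq_left (by linarith), max_eq_left (by linarith), Real.log_div hr.ne' h0.ne', sub_div,
      div_self hl.ne]
    ring
  · have : 2 ≤ Real.log r / Real.log h := by
      rw [le_div_iff_of_neg hl]
      have := Real.log_le_log hr (not_le.1 h3).le
      rw [Real.log_pow] at this
      exact_mod_cast this
    rw [min_eq_left (by linarith), max_eq_right (by linarith)]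

lemma sq_logCutoff_sub_le {h r t : ℝ} (h0 : 0 < h) (h1 : h < 1) (hr : 0 < r) (ht : 0 < t) :
    (logCutoff h r - logCutoff h t) ^ 2 ≤
      (Real.log r - Real.log t) ^ 2 * (|Real.log h|⁻¹) ^ 2 := by
  rw [← mul_pow, sq_le_sq, logCutoff_eq_max_min h0 h1 hr, logCutoff_eq_max_min h0 h1 ht]
  calc _ ≤ |min (2 - Real.log r / Real.log h) 1 - min (2 - Real.log t / Real.log h) 1| :=
        abs_max_sub_max_le_abs _ _ _
    _ ≤ max |2 - Real.log r / Real.log h - (2 - Real.log t / Real.log h)| |(1 : ℝ) - 1| :=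
        abs_min_sub_min_le_max _ _ _ _
    _ = |(Real.log t - Real.log r) / Real.log h| := by
        rw [sub_self, abs_zero, max_eq_left (abs_nonneg _)]
        congr 1
        ring
    _ = _ := by
        rw [abs_div, abs_mul, abs_inv, abs_abs, div_eq_mul_inv, abs_sub_comm]

/-- A symmetric kernel that vanishes on `S₁ × S₁` has energy at most twice its energy over
`S₂ × (S₁ ∪ S₂)`. -/
lemma lintegral_lintegral_union_le_of_symm {α : Type*} [MeasurableSpace α] (μ : Measure α)
    [SFinite μ] {G : α → α → ENNReal} (hG : Measurable (Function.uncurry G))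
    (hsymm : ∀ x y, G x y = G y x) {S₁ S₂ : Set α} (hS₁ : MeasurableSet S₁)
    (h0 : ∀ x ∈ S₁, ∀ y ∈ S₁, G x y = 0) :
    ∫⁻ x in S₁ ∪ S₂, ∫⁻ y in S₁ ∪ S₂, G x y ∂μ ∂μ ≤
      2 * ∫⁻ x in S₂, ∫⁻ y in S₁ ∪ S₂, G x y ∂μ ∂μ := by
  have h1 : ∫⁻ x in S₁, ∫⁻ y in S₁ ∪ S₂, G x y ∂μ ∂μ ≤
      ∫⁻ x in S₂, ∫⁻ y in S₁ ∪ S₂, G x y ∂μ ∂μ :=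
    calc _ ≤ ∫⁻ x in S₁, ∫⁻ y in S₂, G x y ∂μ ∂μ := by
          refine setLIntegral_mono' hS₁ fun x hx => (lintegral_union_le _ _ _).trans ?_
          rw [setLIntegral_congr_fun hS₁ (h0 x hx)]
          simp
      _ = ∫⁻ y in S₂, ∫⁻ x in S₁, G x y ∂μ ∂μ := lintegral_lintegral_swap hG.aemeasurable
      _ ≤ _ := by
          refine lintegral_mono fun y => ?_
          simp only [hsymm _ y]
          exact lintegral_mono_set Set.subset_union_left
  rw [two_mul]
  exact (lintegral_union_le _ _ _).trans (by gcongr)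

/-- Bochner integrals of nonnegative kernels are controlled by their iterated upper integrals. -/
lemma integral_integral_le_of_lintegral_lintegral_le {α : Type*} [MeasurableSpace α]
    {μ : Measure α} {f : α → α → ℝ} (hf : ∀ x y, 0 ≤ f x y) {c : ℝ} (hc : 0 ≤ c)
    (h : ∫⁻ x, ∫⁻ y, ENNReal.ofReal (f x y) ∂μ ∂μ ≤ ENNReal.ofReal c) :
    ∫ x, ∫ y, f x y ∂μ ∂μ ≤ c := by
  refine (le_abs_self _).trans ?_
  rw [← ENNReal.ofReal_le_ofReal_iff hc, ← Real.enorm_eq_ofReal_abs]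
  refine ((enorm_integral_le_lintegral_enorm _).trans (lintegral_mono fun x => ?_)).trans h
  refine (enorm_integral_le_lintegral_enorm _).trans (lintegral_mono fun y => ?_)
  rw [Real.enorm_of_nonneg (hf x y)]

/-- Weighted Gagliardo energy of the logarithmic cut-off. -/
lemma exists_lintegral_logCutoff_energy_le {E : Type*} [NormedAddCommGroup E] [NormedSpace ℝ E]
    [FiniteDimensional ℝ E] [Nontrivial E] [MeasurableSpace E] [BorelSpace E] (μ : Measure E)
    [μ.IsAddHaarMeasure] {s γ : ℝ} (hs0 : 0 < s) (hs1 : s < 1)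
    (hγ0 : (2 * s - Module.finrank ℝ E) / 2 ≤ γ) (hγ1 : γ < 2 * s) :
    ∃ C > 0, ∀ h ∈ Set.Ioo (0 : ℝ) (1 / 8),
      ∫⁻ x in {x : E | ‖x‖ ≤ 2 * h}, ∫⁻ y in {y : E | ‖y‖ ≤ 2 * h},
        ENNReal.ofReal ((logCutoff h ‖x‖ - logCutoff h ‖y‖) ^ 2 *
          ‖x - y‖ ^ (-(Module.finrank ℝ E + 2 * s)) * ‖y‖ ^ γ * ‖x‖ ^ γ) ∂μ ∂μ ≤
      ENNReal.ofReal (C * |Real.log h|⁻¹) := by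
  have hd : 0 < (Module.finrank ℝ E : ℝ) := Nat.cast_pos.2 Module.finrank_pos
  obtain ⟨A, hA, hker⟩ := exists_lintegral_log_kernel_le μ hs0 hs1
    (show -(Module.finrank ℝ E : ℝ) < γ by linarith) hγ1
  obtain ⟨B, hB, hann⟩ := exists_setLIntegral_norm_rpow_Icc_le (E := E) μ
  refine ⟨2 * (A * (B * 2)), by positivity, fun h ⟨h0, h8⟩ => ?_⟩
  have h1 : h < 1 := by linarith
  have hl : Real.log h < 0 := Real.log_neg h0 h1
  have hL : 0 < |Real.log h| := abs_pos.2 hl.ne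
  have hsq : h ^ 2 ≤ 2 * h := by nlinarith
  set G : E → E → ENNReal := fun x y =>
    ENNReal.ofReal ((logCutoff h ‖x‖ - logCutoff h ‖y‖) ^ 2 *
      ‖x - y‖ ^ (-(Module.finrank ℝ E + 2 * s)) * ‖y‖ ^ γ * ‖x‖ ^ γ) with hGdef
  have hGm : Measurable (Function.uncurry G) := by
    have := measurable_logCutoff h
    simp only [hGdef, Function.uncurry_def]
    fun_prop
  have hGsymm : ∀ x y, G x y = G y x := fun x y => by
    simp only [hGdef]
    rw [norm_sub_rev, ← neg_sub (logCutoff h ‖x‖), neg_sq, mul_right_comm]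
  set S₁ : Set E := {x : E | ‖x‖ < h ^ 2}
  set S₂ : Set E := {x : E | ‖x‖ ∈ Set.Icc (h ^ 2) (2 * h)}
  have hS₁ : MeasurableSet S₁ := measurableSet_lt measurable_norm measurable_const
  have hS₂ : MeasurableSet S₂ := measurable_norm measurableSet_Icc
  have hS : {x : E | ‖x‖ ≤ 2 * h} = S₁ ∪ S₂ := by
    ext x
    refine ⟨fun hx => (lt_or_ge ‖x‖ (h ^ 2)).imp id fun hx' => ⟨hx', hx⟩, ?_⟩
    rintro (hx | hx)
    · exact (le_of_lt hx).trans hsq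
    · exact hx.2
  have hG0 : ∀ x ∈ S₁, ∀ y ∈ S₁, G x y = 0 := fun x hx y hy => by
    simp only [hGdef]
    rw [logCutoff_of_lt h0 h1 hx, logCutoff_of_lt h0 h1 hy]
    simp
  have hinner : ∀ x ∈ S₂, ∫⁻ y in S₁ ∪ S₂, G x y ∂μ ≤
      ENNReal.ofReal (A * (|Real.log h|⁻¹) ^ 2) *
        ENNReal.ofReal (‖x‖ ^ (-(Module.finrank ℝ E : ℝ))) := by
    rintro x ⟨hx1, hx2⟩
    have hr : 0 < ‖x‖ := (by positivity : 0 < h ^ 2).trans_le hx1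
    calc _ ≤ ∫⁻ y, G x y ∂μ := setLIntegral_le_lintegral _ _
      _ ≤ ∫⁻ y, ENNReal.ofReal ((|Real.log h|⁻¹) ^ 2 * ‖x‖ ^ γ) *
          ENNReal.ofReal ((Real.log ‖x‖ - Real.log ‖y‖) ^ 2 *
            ‖x - y‖ ^ (-(Module.finrank ℝ E + 2 * s)) * ‖y‖ ^ γ) ∂μ := by
          refine lintegral_mono_ae ?_
          filter_upwards [Measure.ae_ne μ 0] with y hy
          rw [← ENNReal.ofReal_mul (by positivity)]
          apply ENNReal.ofReal_le_ofReal
          have := sq_logCutoff_sub_le h0 h1 hr (norm_pos_iff.2 hy)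
          calc _ ≤ ((Real.log ‖x‖ - Real.log ‖y‖) ^ 2 * (|Real.log h|⁻¹) ^ 2) *
                ‖x - y‖ ^ (-(Module.finrank ℝ E + 2 * s)) * ‖y‖ ^ γ * ‖x‖ ^ γ := by gcongr
            _ = _ := by ring
      _ ≤ ENNReal.ofReal ((|Real.log h|⁻¹) ^ 2 * ‖x‖ ^ γ) *
          ENNReal.ofReal (A * ‖x‖ ^ (γ - 2 * s)) := by
          rw [lintegral_const_mul' _ _ ENNReal.ofReal_ne_top]
          gcongr
          exact hker x (norm_pos_iff.1 hr)
      _ ≤ _ := by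
          rw [← ENNReal.ofReal_mul (by positivity), ← ENNReal.ofReal_mul (by positivity)]
          apply ENNReal.ofReal_le_ofReal
          have : ‖x‖ ^ (γ + (γ - 2 * s)) ≤ ‖x‖ ^ (-(Module.finrank ℝ E : ℝ)) :=
            Real.rpow_le_rpow_of_exponent_ge hr (by linarith) (by linarith)
          calc _ = A * (|Real.log h|⁻¹) ^ 2 * ‖x‖ ^ (γ + (γ - 2 * s)) := by
                rw [Real.rpow_add hr]
                ring
            _ ≤ _ := by gcongr
  have hlog : Real.log (2 * h / h ^ 2) ≤ 2 * |Real.log h| := by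
    rw [abs_of_neg hl, Real.log_div (by positivity) (by positivity), Real.log_pow,
      Real.log_mul two_ne_zero h0.ne']
    have : Real.log 2 + Real.log h ≤ 0 := by
      rw [← Real.log_mul two_ne_zero h0.ne']
      exact Real.log_nonpos (by positivity) (by linarith)
    push_cast
    linarith
  rw [hS]
  calc _ ≤ 2 * ∫⁻ x in S₂, ∫⁻ y in S₁ ∪ S₂, G x y ∂μ ∂μ :=
        lintegral_lintegral_union_le_of_symm μ hGm hGsymm hS₁ hG0
    _ ≤ 2 * ∫⁻ x in S₂, ENNReal.ofReal (A * (|Real.log h|⁻¹) ^ 2) *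
        ENNReal.ofReal (‖x‖ ^ (-(Module.finrank ℝ E : ℝ))) ∂μ := by
        gcongr 2 * ?_
        exact setLIntegral_mono' hS₂ hinner
    _ ≤ ENNReal.ofReal 2 * (ENNReal.ofReal (A * (|Real.log h|⁻¹) ^ 2) *
          ENNReal.ofReal (B * (2 * |Real.log h|))) := by
        rw [lintegral_const_mul' _ _ ENNReal.ofReal_ne_top, ENNReal.ofReal_ofNat]
        gcongr
        refine (hann _ (by positivity) _ hsq).trans (ENNReal.ofReal_le_ofReal ?_)
        gcongr
    _ = _ := by
        rw [← ENNReal.ofReal_mul (by positivity), ← ENNReal.ofReal_mul (by positivity)]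
        congr 1
        field_simp

/-- Key energy estimate for the logarithmic cut-off η_h: there is a constant
`c = c(N,s,γ)` (independent of h) such that for all sufficiently small `h`,
the weighted Gagliardo energy of η_h over `B_{2h} × B_{2h}` is at most
`c |log h|⁻¹`. -/
theorem eta_cutoff_energy_estimate (N : ℕ) (hN : 2 ≤ N) (s γ : ℝ)
    (hs : s ∈ Set.Ioo (0 : ℝ) 1) (hγ : γ ∈ Set.Ico ((2 * s - N) / 2) (2 * s)) :
    let η : ℝ → EuclideanSpace ℝ (Fin N) → ℝ := fun h x =>
      if h < ‖x‖ then 1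
      else if h ^ 2 ≤ ‖x‖ then 1 - Real.log (‖x‖ / h) / Real.log h
      else 0
    ∃ c > 0, ∃ h₀ ∈ Set.Ioo (0 : ℝ) (1 / 4), ∀ h ∈ Set.Ioo (0 : ℝ) h₀,
      (∫ x in {x : EuclideanSpace ℝ (Fin N) | ‖x‖ ≤ 2 * h},
        ∫ y in {y : EuclideanSpace ℝ (Fin N) | ‖y‖ ≤ 2 * h},
          (η h x - η h y) ^ 2 * ‖x - y‖ ^ (-((N : ℝ) + 2 * s)) * ‖y‖ ^ γ * ‖x‖ ^ γ)
        ≤ c * |Real.log h|⁻¹ := by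
  have : Nonempty (Fin N) := ⟨⟨0, by omega⟩⟩
  have hfr : Module.finrank ℝ (EuclideanSpace ℝ (Fin N)) = N := by simp
  obtain ⟨C, hC, hbound⟩ := exists_lintegral_logCutoff_energy_le
    (volume : Measure (EuclideanSpace ℝ (Fin N))) hs.1 hs.2 (by rw [hfr]; exact hγ.1) hγ.2
  rw [hfr] at hbound
  intro η
  refine ⟨C, hC, 1 / 8, by norm_num, fun h hh => ?_⟩
  exact integral_integral_le_of_lintegral_lintegral_le (fun x y => by positivity) (by positivity)
    (hbound h hh)
end

section
/- Let Ω ⊂ R^N be a bounded open set, γ ∈ [(2s-N)/2, 2s), s ∈ (0,1), N ≥ 2, μ ≥ μ₀ with τ₊(s,μ) = γ. For every u ∈ C_0^∞(Ω \ {0}) and v defined by v(x) = |x|^{-γ} u(x), one has the identity (C_{N,s}/2) ∫∫_{R^N×R^N} |u(x)-u(y)|²|x-y|^{-(N+2s)} dy dx + μ ∫_{R^N} u(x)²|x|^{-2s} dx = (C_{N,s}/2) ∫∫_{R^N×R^N} |v(x)-v(y)|²|x-y|^{-(N+2s)} |y|^γ |x|^γ dy dx. -/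
open MeasureTheory

section Tonelli

variable {α β : Type*} [MeasurableSpace α] [MeasurableSpace β] {μ : Measure α} {ν : Measure β}
  [SFinite μ] [SFinite ν]

/-- Tonelli's criterion for real functions that are nonnegative on almost every slice. -/
theorem integrable_prod_of_nonneg_slices {f : α × β → ℝ} {G : β → ℝ}
    (hf : AEStronglyMeasurable f (μ.prod ν))
    (h0 : ∀ᵐ y ∂ν, ∀ᵐ x ∂μ, 0 ≤ f (x, y))
    (hi : ∀ᵐ y ∂ν, Integrable (fun x => f (x, y)) μ)
    (hG : ∀ᵐ y ∂ν, ∫ x, f (x, y) ∂μ = G y) (hGi : Integrable G ν) :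
    Integrable f (μ.prod ν) := by
  refine (integrable_prod_iff' hf).2 ⟨hi, hGi.congr ?_⟩
  filter_upwards [h0, hG] with y h1 h2
  rw [← h2]
  refine integral_congr_ae ?_
  filter_upwards [h1] with x hx
  rw [Real.norm_of_nonneg hx]

/-- Tonelli's theorem, in a form where both iterated inner integrals are given. -/
theorem integrable_and_integral_eq_of_slices {f : α × β → ℝ} {F : α → ℝ} {G : β → ℝ}
    (hf : AEStronglyMeasurable f (μ.prod ν))
    (h0 : ∀ᵐ y ∂ν, ∀ᵐ x ∂μ, 0 ≤ f (x, y))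
    (hi : ∀ᵐ y ∂ν, Integrable (fun x => f (x, y)) μ)
    (hG : ∀ᵐ y ∂ν, ∫ x, f (x, y) ∂μ = G y) (hGi : Integrable G ν)
    (hF : ∀ᵐ x ∂μ, ∫ y, f (x, y) ∂ν = F x) :
    Integrable F μ ∧ ∫ x, F x ∂μ = ∫ y, G y ∂ν := by
  have hfi := integrable_prod_of_nonneg_slices hf h0 hi hG hGi
  refine ⟨hfi.integral_prod_left.congr hF, ?_⟩
  rw [← integral_congr_ae hF, ← integral_congr_ae hG]
  exact integral_integral_swap (f := fun x y => f (x, y)) hfi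

end Tonelli

section OneDim

open Set

theorem integrableOn_rpow_mul_exp_neg_mul_Ioi {a r : ℝ} (ha : 0 < a) (hr : 0 < r) :
    IntegrableOn (fun t : ℝ => t ^ (a - 1) * Real.exp (-(r * t))) (Ioi 0) := by
  by_contra h
  have h1 := Real.integral_rpow_mul_exp_neg_mul_Ioi ha hr
  rw [integral_undef h] at h1
  have : 0 < (1 / r) ^ a * Real.Gamma a := by
    have := Real.Gamma_pos_of_pos ha
    positivity
  linarith

theorem integral_rpow_mul_exp_neg_mul_Ioi' {a r : ℝ} (ha : 0 < a) (hr : 0 < r) :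
    ∫ t in Ioi (0 : ℝ), t ^ (a - 1) * Real.exp (-(r * t)) = r ^ (-a) * Real.Gamma a := by
  rw [Real.integral_rpow_mul_exp_neg_mul_Ioi ha hr, one_div, Real.inv_rpow hr.le,
    Real.rpow_neg hr.le]

/-- A Frullani type integral. -/
theorem integral_rpow_mul_exp_sub_exp_of_le {α p q : ℝ} (hα : -1 < α) (hα0 : α ≠ 0) (hp : 0 < p)
    (hpq : p ≤ q) :
    IntegrableOn (fun a : ℝ => a ^ (α - 1) * (Real.exp (-(p * a)) - Real.exp (-(q * a))))
      (Ioi 0) ∧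
    ∫ a in Ioi (0 : ℝ), a ^ (α - 1) * (Real.exp (-(p * a)) - Real.exp (-(q * a))) =
      Real.Gamma α * (p ^ (-α) - q ^ (-α)) := by
  have hmem : ∀ᵐ c ∂(volume.restrict (Ioc p q)), c ∈ Ioc p q := ae_restrict_mem measurableSet_Ioc
  have hmem' : ∀ᵐ a ∂(volume.restrict (Ioi (0 : ℝ))), a ∈ Ioi (0 : ℝ) :=
    ae_restrict_mem measurableSet_Ioi
  have key := integrable_and_integral_eq_of_slices (μ := volume.restrict (Ioi (0 : ℝ)))
    (ν := volume.restrict (Ioc p q))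
    (f := fun z => z.1 ^ (α + 1 - 1) * Real.exp (-(z.2 * z.1)))
    (F := fun a : ℝ => a ^ (α - 1) * (Real.exp (-(p * a)) - Real.exp (-(q * a))))
    (G := fun c => c ^ (-(α + 1)) * Real.Gamma (α + 1)) ?_ ?_ ?_ ?_ ?_ ?_
  · refine ⟨key.1, key.2.trans ?_⟩
    rw [← intervalIntegral.integral_of_le hpq, intervalIntegral.integral_mul_const,
      integral_rpow, Real.Gamma_add_one hα0]
    · have : -(α + 1) + 1 = -α := by ring
      rw [this]
      field_simp
      ring
    · right
      refine ⟨by contrapose! hα0; linarith, ?_⟩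
      rw [uIcc_of_le hpq]
      exact fun h => absurd h.1 (not_le.2 hp)
  · exact (by fun_prop : Measurable _).aestronglyMeasurable
  · filter_upwards with c
    filter_upwards [hmem'] with a ha
    have : (0 : ℝ) < a := ha
    positivity
  · filter_upwards [hmem] with c hc
    exact integrableOn_rpow_mul_exp_neg_mul_Ioi (by linarith) (hp.trans hc.1)
  · filter_upwards [hmem] with c hc
    exact integral_rpow_mul_exp_neg_mul_Ioi' (by linarith) (hp.trans hc.1)
  · refine Integrable.mul_const ?_ _
    refine (ContinuousOn.integrableOn_Icc ?_).mono_set Ioc_subset_Icc_self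
    exact continuousOn_id.rpow_const fun x hx => Or.inl (hp.trans_le hx.1).ne'
  · filter_upwards [hmem'] with a ha
    have ha : (0 : ℝ) < a := ha
    rw [← intervalIntegral.integral_of_le hpq, intervalIntegral.integral_const_mul,
      intervalIntegral.integral_eq_sub_of_hasDerivAt
        (f := fun c => -(Real.exp (-(c * a)) / a)) (f' := fun c => Real.exp (-(c * a)))]
    · have : a ^ (α + 1 - 1) = a ^ (α - 1) * a := by
        rw [← Real.rpow_add_one ha.ne']; ring_nf
      rw [this]
      field_simp
      ring
    · intro c _
      have h := ((((hasDerivAt_id c).mul_const a).neg.exp).div_const a).neg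
      refine h.congr_deriv ?_
      simp only [id, Pi.neg_apply, neg_mul_eq_neg_mul]
      field_simp
    · exact (by fun_prop : Continuous fun c => Real.exp (-(c * a))).intervalIntegrable _ _

theorem integral_rpow_mul_exp_sub_exp {α p q : ℝ} (hα : -1 < α) (hα0 : α ≠ 0) (hp : 0 < p)
    (hq : 0 < q) :
    IntegrableOn (fun a : ℝ => a ^ (α - 1) * (Real.exp (-(p * a)) - Real.exp (-(q * a))))
      (Ioi 0) ∧
    ∫ a in Ioi (0 : ℝ), a ^ (α - 1) * (Real.exp (-(p * a)) - Real.exp (-(q * a))) =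
      Real.Gamma α * (p ^ (-α) - q ^ (-α)) := by
  rcases le_total p q with h | h
  · exact integral_rpow_mul_exp_sub_exp_of_le hα hα0 hp h
  · obtain ⟨h1, h2⟩ := integral_rpow_mul_exp_sub_exp_of_le hα hα0 hq h
    have he : (fun a : ℝ => a ^ (α - 1) * (Real.exp (-(p * a)) - Real.exp (-(q * a)))) =
        fun a => -(a ^ (α - 1) * (Real.exp (-(q * a)) - Real.exp (-(p * a)))) := by
      ext a; ring
    rw [he, integral_neg, h2]
    exact ⟨h1.neg, by ring⟩

theorem integral_abs_rpow_mul_exp_sub_exp {α p q : ℝ} (hα : -1 < α) (hα0 : α ≠ 0) (hp : 0 < p)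
    (hq : 0 < q) :
    ∫ a in Ioi (0 : ℝ), |a ^ (α - 1) * (Real.exp (-(p * a)) - Real.exp (-(q * a)))| =
      |Real.Gamma α * (p ^ (-α) - q ^ (-α))| := by
  have hle : ∀ {p q : ℝ}, 0 < p → p ≤ q →
      ∫ a in Ioi (0 : ℝ), |a ^ (α - 1) * (Real.exp (-(p * a)) - Real.exp (-(q * a)))| =
      |Real.Gamma α * (p ^ (-α) - q ^ (-α))| := by
    intro p q hp hpq
    have h0 : ∀ a ∈ Ioi (0 : ℝ),
        0 ≤ a ^ (α - 1) * (Real.exp (-(p * a)) - Real.exp (-(q * a))) := by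
      intro a ha
      have ha : (0 : ℝ) < a := ha
      refine mul_nonneg (by positivity) (sub_nonneg.2 (Real.exp_le_exp.2 ?_))
      nlinarith
    rw [← (integral_rpow_mul_exp_sub_exp hα hα0 hp (hp.trans_le hpq)).2,
      abs_of_nonneg (setIntegral_nonneg measurableSet_Ioi h0)]
    exact setIntegral_congr_fun measurableSet_Ioi fun a ha => abs_of_nonneg (h0 a ha)
  rcases le_total p q with h | h
  · exact hle hp h
  · have h1 := hle hq h
    rw [abs_mul, abs_sub_comm, ← abs_mul, ← h1]
    congr 1
    ext a
    rw [abs_mul, abs_sub_comm, ← abs_mul]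

/-- Euler's beta integral over the half line. -/
theorem integral_rpow_mul_one_add_rpow {m n : ℝ} (hm : 0 < m) (hn : 0 < n) :
    IntegrableOn (fun σ : ℝ => σ ^ (m - 1) * (1 + σ) ^ (-(m + n))) (Ioi 0) ∧
    ∫ σ in Ioi (0 : ℝ), σ ^ (m - 1) * (1 + σ) ^ (-(m + n)) =
      Real.Gamma m * Real.Gamma n / Real.Gamma (m + n) := by
  have hΓ : Real.Gamma (m + n) ≠ 0 := (Real.Gamma_pos_of_pos (by linarith)).ne'
  have hmem : ∀ᵐ a ∂(volume.restrict (Ioi (0 : ℝ))), a ∈ Ioi (0 : ℝ) :=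
    ae_restrict_mem measurableSet_Ioi
  have hs : ∀ c ∈ Ioi (0 : ℝ), ∀ σ : ℝ, σ ^ (m - 1) * c ^ (m + n - 1) *
      Real.exp (-((1 + σ) * c)) =
      c ^ (m + n - 1) * Real.exp (-c) * (σ ^ (m - 1) * Real.exp (-(c * σ))) := by
    intro c _ σ
    have : Real.exp (-((1 + σ) * c)) = Real.exp (-c) * Real.exp (-(c * σ)) := by
      rw [← Real.exp_add]; ring_nf
    rw [this]; ring
  have key := integrable_and_integral_eq_of_slices (μ := volume.restrict (Ioi (0 : ℝ)))
    (ν := volume.restrict (Ioi (0 : ℝ)))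
    (f := fun z => z.1 ^ (m - 1) * z.2 ^ (m + n - 1) * Real.exp (-((1 + z.1) * z.2)))
    (F := fun σ : ℝ => Real.Gamma (m + n) * (σ ^ (m - 1) * (1 + σ) ^ (-(m + n))))
    (G := fun c => Real.Gamma m * (c ^ (n - 1) * Real.exp (-(1 * c)))) ?_ ?_ ?_ ?_ ?_ ?_
  · rw [integral_const_mul, integral_const_mul,
      integral_rpow_mul_exp_neg_mul_Ioi' hn one_pos] at key
    constructor
    · exact (integrable_const_mul_iff (isUnit_iff_ne_zero.2 hΓ) _).1 key.1
    · rw [eq_div_iff hΓ, mul_comm, key.2]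
      simp
  · exact (by fun_prop : Measurable _).aestronglyMeasurable
  · filter_upwards [hmem] with c hc
    filter_upwards [hmem] with a ha
    have : (0 : ℝ) < a := ha
    have : (0 : ℝ) < c := hc
    positivity
  · filter_upwards [hmem] with c hc
    simp only [hs c hc]
    exact (integrableOn_rpow_mul_exp_neg_mul_Ioi hm hc).const_mul _
  · filter_upwards [hmem] with c hc
    simp only [hs c hc]
    have hc : (0 : ℝ) < c := hc
    rw [integral_const_mul, integral_rpow_mul_exp_neg_mul_Ioi' hm hc]
    have : c ^ (n - 1) = c ^ (m + n - 1) * c ^ (-m) := by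
      rw [← Real.rpow_add hc]; ring_nf
    rw [this, one_mul]; ring
  · exact (integrableOn_rpow_mul_exp_neg_mul_Ioi hn one_pos).const_mul _
  · filter_upwards [hmem] with σ hσ
    have hσ : (0 : ℝ) < σ := hσ
    simp only [mul_assoc]
    rw [integral_const_mul, integral_rpow_mul_exp_neg_mul_Ioi' (by linarith) (by linarith)]
    ring

theorem integral_Ioo_rpow_sub_one {s ρ : ℝ} (hs : 0 < s) (hρ : 0 < ρ) :
    IntegrableOn (fun σ : ℝ => σ ^ (s - 1)) (Ioo 0 ρ) ∧
      ∫ σ in Ioo 0 ρ, σ ^ (s - 1) = ρ ^ s / s := by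
  constructor
  · rw [← integrableOn_Ioc_iff_integrableOn_Ioo, ← intervalIntegrable_iff_integrableOn_Ioc_of_le hρ.le]
    exact intervalIntegral.intervalIntegrable_rpow' (by linarith)
  · rw [← integral_Ioc_eq_integral_Ioo, ← intervalIntegral.integral_of_le hρ.le,
      integral_rpow (Or.inl (by linarith))]
    simp [Real.zero_rpow hs.ne']

theorem integral_Ioi_deriv_div_one_add_rpow {κ σ : ℝ} (hκ : 0 < κ) (hσ : 0 < σ) :
    ∫ ρ in Ioi σ, κ * ρ ^ (κ - 1) * (1 + ρ) ^ (-(κ + 1)) = 1 - (σ / (1 + σ)) ^ κ := by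
  refine integral_Ioi_of_hasDerivAt_of_nonneg' (g := fun ρ => (ρ / (1 + ρ)) ^ κ) ?_ ?_ ?_
  · intro ρ hρ
    have hρ : 0 < ρ := hσ.trans_le hρ
    have h1 : HasDerivAt (fun ρ : ℝ => ρ / (1 + ρ)) (1 / (1 + ρ) ^ 2) ρ := by
      have := (hasDerivAt_id ρ).div ((hasDerivAt_id ρ).const_add 1)
        (by simp only [id]; positivity)
      refine this.congr_deriv ?_
      simp
    refine (h1.rpow_const (p := κ) (Or.inl (by positivity))).congr_deriv ?_
    rw [Real.div_rpow hρ.le (by positivity), show -(κ + 1) = -(κ - 1) - 2 by ring,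
      Real.rpow_sub (x := 1 + ρ) (by positivity) (-(κ - 1)) 2, Real.rpow_neg (by positivity)]
    norm_cast
    field_simp
  · intro ρ hρ
    have hρ : 0 < ρ := hσ.trans hρ
    positivity
  · have h1 : Filter.Tendsto (fun ρ : ℝ => ρ / (1 + ρ)) Filter.atTop (nhds 1) := by
      have h2 : Filter.Tendsto (fun ρ : ℝ => 1 - (1 + ρ)⁻¹) Filter.atTop (nhds (1 - 0)) :=
        (tendsto_inv_atTop_zero.comp
          (Filter.tendsto_atTop_add_const_left _ 1 Filter.tendsto_id)).const_sub 1
      rw [sub_zero] at h2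
      refine h2.congr' ?_
      filter_upwards [Filter.eventually_gt_atTop 0] with ρ hρ
      field_simp
      ring
    have h3 := h1.rpow_const (p := κ) (Or.inl one_ne_zero)
    rwa [Real.one_rpow] at h3

/-- The Mellin transform of `1 - (σ / (1 + σ)) ^ κ`. -/
theorem integral_rpow_mul_one_sub_div_rpow {s κ : ℝ} (hs : 0 < s) (hs1 : s < 1) (hκ : 0 < κ) :
    IntegrableOn (fun σ : ℝ => σ ^ (s - 1) * (1 - (σ / (1 + σ)) ^ κ)) (Ioi 0) ∧
    ∫ σ in Ioi (0 : ℝ), σ ^ (s - 1) * (1 - (σ / (1 + σ)) ^ κ) =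
      Real.Gamma (κ + s) * Real.Gamma (1 - s) / (s * Real.Gamma κ) := by
  have hmem : ∀ᵐ a ∂(volume.restrict (Ioi (0 : ℝ))), a ∈ Ioi (0 : ℝ) :=
    ae_restrict_mem measurableSet_Ioi
  have hsl : ∀ ρ : ℝ, 0 < ρ → (fun σ : ℝ => {z : ℝ × ℝ | z.1 < z.2}.indicator
      (fun z => z.1 ^ (s - 1) * (κ * z.2 ^ (κ - 1) * (1 + z.2) ^ (-(κ + 1)))) (σ, ρ)) =
      (Iio ρ).indicator
        (fun σ => σ ^ (s - 1) * (κ * ρ ^ (κ - 1) * (1 + ρ) ^ (-(κ + 1)))) := by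
    intro ρ _; ext σ; simp [indicator]
  have hsl' : ∀ σ : ℝ, (fun ρ : ℝ => {z : ℝ × ℝ | z.1 < z.2}.indicator
      (fun z => z.1 ^ (s - 1) * (κ * z.2 ^ (κ - 1) * (1 + z.2) ^ (-(κ + 1)))) (σ, ρ)) =
      (Ioi σ).indicator
        (fun ρ => σ ^ (s - 1) * (κ * ρ ^ (κ - 1) * (1 + ρ) ^ (-(κ + 1)))) := by
    intro σ; ext ρ; simp [indicator]
  have hbeta := integral_rpow_mul_one_add_rpow (m := κ + s) (n := 1 - s) (by linarith) (by linarith)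
  have hΓ : Real.Gamma κ ≠ 0 := (Real.Gamma_pos_of_pos hκ).ne'
  have key := integrable_and_integral_eq_of_slices (μ := volume.restrict (Ioi (0 : ℝ)))
    (ν := volume.restrict (Ioi (0 : ℝ)))
    (f := {z : ℝ × ℝ | z.1 < z.2}.indicator
      fun z => z.1 ^ (s - 1) * (κ * z.2 ^ (κ - 1) * (1 + z.2) ^ (-(κ + 1))))
    (F := fun σ : ℝ => σ ^ (s - 1) * (1 - (σ / (1 + σ)) ^ κ))
    (G := fun ρ => κ / s * (ρ ^ (κ + s - 1) * (1 + ρ) ^ (-(κ + s + (1 - s))))) ?_ ?_ ?_ ?_ ?_ ?_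
  · refine ⟨key.1, key.2.trans ?_⟩
    rw [integral_const_mul, hbeta.2, show κ + s + (1 - s) = κ + 1 by ring,
      Real.Gamma_add_one hκ.ne']
    field_simp
  · exact ((by fun_prop : Measurable _).indicator
      (measurableSet_lt measurable_fst measurable_snd)).aestronglyMeasurable
  · filter_upwards [hmem] with ρ hρ
    filter_upwards [hmem] with σ hσ
    have : (0 : ℝ) < ρ := hρ
    have : (0 : ℝ) < σ := hσ
    exact indicator_apply_nonneg fun _ => by positivity
  · filter_upwards [hmem] with ρ hρ
    rw [hsl ρ hρ, integrable_indicator_iff measurableSet_Iio, IntegrableOn,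
      Measure.restrict_restrict measurableSet_Iio, inter_comm, Ioi_inter_Iio]
    exact (integral_Ioo_rpow_sub_one hs hρ).1.mul_const _
  · filter_upwards [hmem] with ρ hρ
    have hρ' : (0 : ℝ) < ρ := hρ
    rw [hsl ρ hρ, integral_indicator measurableSet_Iio,
      Measure.restrict_restrict measurableSet_Iio, inter_comm, Ioi_inter_Iio,
      integral_mul_const, (integral_Ioo_rpow_sub_one hs hρ).2,
      show κ + s + (1 - s) = κ + 1 by ring, show κ + s - 1 = (κ - 1) + s by ring,
      Real.rpow_add hρ']
    ring
  · exact hbeta.1.const_mul _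
  · filter_upwards [hmem] with σ hσ
    have hσ : (0 : ℝ) < σ := hσ
    rw [hsl', integral_indicator measurableSet_Ioi,
      Measure.restrict_restrict measurableSet_Ioi, inter_comm, Ioi_inter_Ioi,
      integral_const_mul, sup_eq_right.2 hσ.le, integral_Ioi_deriv_div_one_add_rpow hκ hσ]

end OneDim

section TwoDim

open Set

theorem integral_rpow_mul_heat_difference {ζ h R p : ℝ} (hζ : 0 < ζ) (hR : 0 < R) (hp : 0 < p)
    (A B : ℝ) :
    IntegrableOn (fun a : ℝ => a ^ (ζ - 1) *
      (A * Real.exp (-(R * a)) + B * (p ^ h * Real.exp (-(R * p * a))))) (Ioi 0) ∧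
    ∫ a in Ioi (0 : ℝ), a ^ (ζ - 1) *
      (A * Real.exp (-(R * a)) + B * (p ^ h * Real.exp (-(R * p * a)))) =
      R ^ (-ζ) * Real.Gamma ζ * (A + B * p ^ (h - ζ)) := by
  have e : (fun a : ℝ => a ^ (ζ - 1) *
      (A * Real.exp (-(R * a)) + B * (p ^ h * Real.exp (-(R * p * a))))) = fun a =>
      A * (a ^ (ζ - 1) * Real.exp (-(R * a))) +
        B * p ^ h * (a ^ (ζ - 1) * Real.exp (-(R * p * a))) := by
    ext a; ring
  have i1 := (integrableOn_rpow_mul_exp_neg_mul_Ioi hζ hR).const_mul A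
  have i2 := (integrableOn_rpow_mul_exp_neg_mul_Ioi hζ (mul_pos hR hp)).const_mul (B * p ^ h)
  rw [e]
  refine ⟨i1.add i2, ?_⟩
  rw [integral_add i1 i2, integral_const_mul, integral_const_mul,
    integral_rpow_mul_exp_neg_mul_Ioi' hζ hR, integral_rpow_mul_exp_neg_mul_Ioi' hζ (by positivity),
    Real.mul_rpow hR.le hp.le, Real.rpow_sub hp, Real.rpow_neg hp.le]
  ring

theorem integrable_heat_kernel_difference {s ζ h R : ℝ} (hs : 0 < s) (hs1 : s < 1) (hζ : 0 < ζ)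
    (hh : ζ < h) (hR : 0 < R) :
    Integrable (fun z : ℝ × ℝ => z.1 ^ (ζ - 1) * (z.2 ^ (s - 1) * (Real.exp (-(R * z.1)) -
      (z.2 / (1 + z.2)) ^ h * Real.exp (-(R * (z.2 / (1 + z.2)) * z.1)))))
      ((volume.restrict (Ioi (0 : ℝ))).prod (volume.restrict (Ioi (0 : ℝ)))) ∧
    ∫ z, z.1 ^ (ζ - 1) * (z.2 ^ (s - 1) * (Real.exp (-(R * z.1)) -
      (z.2 / (1 + z.2)) ^ h * Real.exp (-(R * (z.2 / (1 + z.2)) * z.1))))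
      ∂((volume.restrict (Ioi (0 : ℝ))).prod (volume.restrict (Ioi (0 : ℝ)))) =
      R ^ (-ζ) * Real.Gamma ζ *
        (Real.Gamma (h - ζ + s) * Real.Gamma (1 - s) / (s * Real.Gamma (h - ζ))) ∧
    ∫ z, |z.1 ^ (ζ - 1) * (z.2 ^ (s - 1) * (Real.exp (-(R * z.1)) -
      (z.2 / (1 + z.2)) ^ h * Real.exp (-(R * (z.2 / (1 + z.2)) * z.1))))|
      ∂((volume.restrict (Ioi (0 : ℝ))).prod (volume.restrict (Ioi (0 : ℝ)))) ≤
      R ^ (-ζ) * (Real.Gamma ζ *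
        (2 * (Real.Gamma (h + s) * Real.Gamma (1 - s) / (s * Real.Gamma h)) -
        (Real.Gamma (h - ζ + s) * Real.Gamma (1 - s) / (s * Real.Gamma (h - ζ))))) := by
  have hmem : ∀ᵐ a ∂(volume.restrict (Ioi (0 : ℝ))), a ∈ Ioi (0 : ℝ) :=
    ae_restrict_mem measurableSet_Ioi
  have hmem2 : ∀ᵐ z ∂((volume.restrict (Ioi (0 : ℝ))).prod (volume.restrict (Ioi (0 : ℝ)))),
      0 < z.1 ∧ 0 < z.2 := by
    rw [Measure.prod_restrict]
    filter_upwards [ae_restrict_mem (measurableSet_Ioi.prod measurableSet_Ioi)] with z hz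
    exact hz
  obtain ⟨i1, e1⟩ := integral_rpow_mul_one_sub_div_rpow hs hs1 (hζ.trans hh)
  obtain ⟨i2, e2⟩ := integral_rpow_mul_one_sub_div_rpow hs hs1 (sub_pos.2 hh)
  set f : ℝ × ℝ → ℝ := fun z => z.1 ^ (ζ - 1) * (z.2 ^ (s - 1) * (Real.exp (-(R * z.1)) -
      (z.2 / (1 + z.2)) ^ h * Real.exp (-(R * (z.2 / (1 + z.2)) * z.1)))) with hf
  set g : ℝ × ℝ → ℝ := fun z => z.2 ^ (s - 1) * (z.1 ^ (ζ - 1) *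
      ((1 - 2 * (z.2 / (1 + z.2)) ^ h) * Real.exp (-(R * z.1)) +
      1 * ((z.2 / (1 + z.2)) ^ h * Real.exp (-(R * (z.2 / (1 + z.2)) * z.1))))) with hg
  set G : ℝ → ℝ := fun σ => R ^ (-ζ) * Real.Gamma ζ *
    (2 * (σ ^ (s - 1) * (1 - (σ / (1 + σ)) ^ h)) - σ ^ (s - 1) * (1 - (σ / (1 + σ)) ^ (h - ζ)))
    with hG
  have hfm : Measurable f := by fun_prop
  have hgm : Measurable g := by fun_prop
  have hfg : ∀ z : ℝ × ℝ, 0 < z.1 → 0 < z.2 → |f z| ≤ g z := by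
    intro z h1 h2
    have hp0 : 0 < z.2 / (1 + z.2) := by positivity
    have hp1 : z.2 / (1 + z.2) ≤ 1 := by rw [div_le_one (by positivity)]; linarith
    have hq1 : (z.2 / (1 + z.2)) ^ h ≤ 1 := Real.rpow_le_one hp0.le hp1 (hζ.trans hh).le
    have hq0 : 0 ≤ (z.2 / (1 + z.2)) ^ h := by positivity
    have he : Real.exp (-(R * z.1)) ≤ Real.exp (-(R * (z.2 / (1 + z.2)) * z.1)) := by
      refine Real.exp_le_exp.2 (neg_le_neg ?_)
      have : R * z.1 * (z.2 / (1 + z.2)) ≤ R * z.1 * 1 := by gcongr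
      linarith
    have he0 := Real.exp_pos (-(R * z.1))
    simp only [hf, hg]
    rw [abs_mul, abs_mul, abs_of_nonneg (by positivity : 0 ≤ z.1 ^ (ζ - 1)),
      abs_of_nonneg (by positivity : 0 ≤ z.2 ^ (s - 1)), mul_left_comm]
    refine mul_le_mul_of_nonneg_left (mul_le_mul_of_nonneg_left ?_ (by positivity)) (by positivity)
    have k1 : 0 ≤ (1 - (z.2 / (1 + z.2)) ^ h) * Real.exp (-(R * z.1)) :=
      mul_nonneg (by linarith) he0.le
    have k2 : 0 ≤ (z.2 / (1 + z.2)) ^ h *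
      (Real.exp (-(R * (z.2 / (1 + z.2)) * z.1)) - Real.exp (-(R * z.1))) :=
      mul_nonneg hq0 (by linarith)
    rw [abs_le]
    constructor <;> linarith
  have hg0 : ∀ z : ℝ × ℝ, 0 < z.1 → 0 < z.2 → 0 ≤ g z :=
    fun z h1 h2 => (abs_nonneg _).trans (hfg z h1 h2)
  have hp0 : ∀ σ ∈ Ioi (0 : ℝ), 0 < σ / (1 + σ) := fun σ hσ => by
    have : (0 : ℝ) < σ := hσ
    positivity
  have hGi : Integrable G (volume.restrict (Ioi (0 : ℝ))) := ((i1.const_mul 2).sub i2).const_mul _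
  have hgG : ∀ᵐ σ ∂(volume.restrict (Ioi (0 : ℝ))), ∫ a in Ioi (0 : ℝ), g (a, σ) = G σ := by
    filter_upwards [hmem] with σ hσ
    simp only [hg, hG]
    rw [integral_const_mul, (integral_rpow_mul_heat_difference hζ hR (hp0 σ hσ) _ _).2]
    ring
  have hgi : Integrable g
      ((volume.restrict (Ioi (0 : ℝ))).prod (volume.restrict (Ioi (0 : ℝ)))) := by
    refine integrable_prod_of_nonneg_slices hgm.aestronglyMeasurable ?_ ?_ hgG hGi
    · filter_upwards [hmem] with σ hσ
      filter_upwards [hmem] with a ha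
      exact hg0 _ ha hσ
    · filter_upwards [hmem] with σ hσ
      exact (integral_rpow_mul_heat_difference (h := h) hζ hR (hp0 σ hσ)
        (1 - 2 * (σ / (1 + σ)) ^ h) 1).1.const_mul (σ ^ (s - 1))
  have hfi : Integrable f
      ((volume.restrict (Ioi (0 : ℝ))).prod (volume.restrict (Ioi (0 : ℝ)))) := by
    refine hgi.mono' hfm.aestronglyMeasurable ?_
    filter_upwards [hmem2] with z hz
    exact hfg z hz.1 hz.2
  refine ⟨hfi, ?_, ?_⟩
  · rw [integral_prod_symm _ hfi, ← e2, ← integral_const_mul]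
    refine integral_congr_ae ?_
    filter_upwards [hmem] with σ hσ
    have := (integral_rpow_mul_heat_difference (h := h) hζ hR (hp0 σ hσ) 1 (-1)).2
    have e : (fun a : ℝ => f (a, σ)) = fun a => σ ^ (s - 1) * (a ^ (ζ - 1) *
      (1 * Real.exp (-(R * a)) + -1 * ((σ / (1 + σ)) ^ h *
        Real.exp (-(R * (σ / (1 + σ)) * a))))) := by
      ext a; simp only [hf]; ring
    rw [e, integral_const_mul, this]
    ring
  · calc _ ≤ ∫ z, g z ∂((volume.restrict (Ioi (0 : ℝ))).prod (volume.restrict (Ioi (0 : ℝ)))) := by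
          refine integral_mono_ae hfi.abs hgi ?_
          filter_upwards [hmem2] with z hz
          exact hfg z hz.1 hz.2
      _ = ∫ σ in Ioi (0 : ℝ), G σ := by
          rw [integral_prod_symm _ hgi]
          exact integral_congr_ae hgG
      _ = _ := by
          simp only [hG]
          rw [integral_const_mul, integral_sub (i1.const_mul 2) i2, integral_const_mul, e1, e2]
          ring

/-- Multiplicative shear of the quadrant. -/
theorem integrable_prod_Ioi_of_comp_mul {f : ℝ × ℝ → ℝ} (hf : Measurable f)
    (hi : Integrable (fun z : ℝ × ℝ => z.1 * f (z.1, z.1 * z.2))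
      ((volume.restrict (Ioi (0 : ℝ))).prod (volume.restrict (Ioi (0 : ℝ))))) :
    Integrable f ((volume.restrict (Ioi (0 : ℝ))).prod (volume.restrict (Ioi (0 : ℝ)))) ∧
    ∫ z, f z ∂((volume.restrict (Ioi (0 : ℝ))).prod (volume.restrict (Ioi (0 : ℝ)))) =
      ∫ z : ℝ × ℝ, z.1 * f (z.1, z.1 * z.2)
        ∂((volume.restrict (Ioi (0 : ℝ))).prod (volume.restrict (Ioi (0 : ℝ)))) := by
  have hmem : ∀ᵐ a ∂(volume.restrict (Ioi (0 : ℝ))), a ∈ Ioi (0 : ℝ) :=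
    ae_restrict_mem measurableSet_Ioi
  have hscale : ∀ g : ℝ → ℝ, ∀ a ∈ Ioi (0 : ℝ),
      ∫ σ in Ioi (0 : ℝ), a * g (a * σ) = ∫ b in Ioi (0 : ℝ), g b := by
    intro g a ha
    rw [integral_const_mul, integral_comp_mul_left_Ioi g 0 ha, mul_zero, smul_eq_mul,
      mul_inv_cancel_left₀ (ne_of_gt ha)]
  have hfi : Integrable f ((volume.restrict (Ioi (0 : ℝ))).prod (volume.restrict (Ioi (0 : ℝ)))) := by
    obtain ⟨h1, h2⟩ := (integrable_prod_iff hi.aestronglyMeasurable).1 hi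
    refine (integrable_prod_iff hf.aestronglyMeasurable).2 ⟨?_, h2.congr ?_⟩
    · filter_upwards [hmem, h1] with a ha h
      have h' := (integrable_const_mul_iff (isUnit_iff_ne_zero.2 (ne_of_gt ha)) _).1 h
      have := (integrableOn_Ioi_comp_mul_left_iff (fun b => f (a, b)) 0 ha).1 h'
      rwa [mul_zero] at this
    · filter_upwards [hmem] with a ha
      rw [← hscale (fun b => ‖f (a, b)‖) a ha]
      simp only [norm_mul, Real.norm_of_nonneg (le_of_lt ha)]
  refine ⟨hfi, ?_⟩
  rw [integral_prod _ hfi, integral_prod _ hi]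
  refine integral_congr_ae ?_
  filter_upwards [hmem] with a ha
  exact (hscale (fun b => f (a, b)) a ha).symm

/-- The heat kernel computation behind the action of the fractional Laplacian on a power. -/
theorem integrable_subordinated_difference {s α h R : ℝ} (hs : 0 < s) (hs1 : s < 1)
    (hζ : 0 < α + s) (hh : α + s < h) (hR : 0 < R) :
    Integrable (fun b : ℝ => b ^ (h + s - 1) * ∫ a in Ioi (0 : ℝ), a ^ (α - 1) *
      ((Real.pi / b) ^ h * Real.exp (-(R * a)) -
        (Real.pi / (a + b)) ^ h * Real.exp (-(R * (a * b / (a + b))))))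
      (volume.restrict (Ioi (0 : ℝ))) ∧
    ∫ b in Ioi (0 : ℝ), b ^ (h + s - 1) * ∫ a in Ioi (0 : ℝ), a ^ (α - 1) *
      ((Real.pi / b) ^ h * Real.exp (-(R * a)) -
        (Real.pi / (a + b)) ^ h * Real.exp (-(R * (a * b / (a + b))))) =
      Real.pi ^ h * (R ^ (-(α + s)) * Real.Gamma (α + s) *
        (Real.Gamma (h - α) * Real.Gamma (1 - s) / (s * Real.Gamma (h - (α + s))))) ∧
    ∫ b in Ioi (0 : ℝ), |b ^ (h + s - 1) * ∫ a in Ioi (0 : ℝ), a ^ (α - 1) *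
      ((Real.pi / b) ^ h * Real.exp (-(R * a)) -
        (Real.pi / (a + b)) ^ h * Real.exp (-(R * (a * b / (a + b)))))| ≤
      Real.pi ^ h * (R ^ (-(α + s)) * (Real.Gamma (α + s) *
        (2 * (Real.Gamma (h + s) * Real.Gamma (1 - s) / (s * Real.Gamma h)) -
        (Real.Gamma (h - α) * Real.Gamma (1 - s) / (s * Real.Gamma (h - (α + s))))))) := by
  have hmem2 : ∀ᵐ z ∂((volume.restrict (Ioi (0 : ℝ))).prod (volume.restrict (Ioi (0 : ℝ)))),
      0 < z.1 ∧ 0 < z.2 := by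
    rw [Measure.prod_restrict]
    filter_upwards [ae_restrict_mem (measurableSet_Ioi.prod measurableSet_Ioi)] with z hz
    exact hz
  obtain ⟨k1, k2, k3⟩ := integrable_heat_kernel_difference hs hs1 hζ hh hR
  rw [show h - (α + s) + s = h - α by ring] at k2 k3
  set P := (volume.restrict (Ioi (0 : ℝ))).prod (volume.restrict (Ioi (0 : ℝ))) with hP
  set f : ℝ × ℝ → ℝ := fun z => z.2 ^ (h + s - 1) * (z.1 ^ (α - 1) *
      ((Real.pi / z.2) ^ h * Real.exp (-(R * z.1)) -
        (Real.pi / (z.1 + z.2)) ^ h * Real.exp (-(R * (z.1 * z.2 / (z.1 + z.2)))))) with hf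
  set k : ℝ × ℝ → ℝ := fun z : ℝ × ℝ => z.1 ^ (α + s - 1) * (z.2 ^ (s - 1) *
    (Real.exp (-(R * z.1)) -
      (z.2 / (1 + z.2)) ^ h * Real.exp (-(R * (z.2 / (1 + z.2)) * z.1)))) with hk
  have hfm : Measurable f := by fun_prop
  have hfk : ∀ᵐ z ∂P, Real.pi ^ h * k z = z.1 * f (z.1, z.1 * z.2) := by
    filter_upwards [hmem2] with z hz
    obtain ⟨ha, hb⟩ := hz
    simp only [hf, hk]
    have e1 : z.1 * (z.1 * z.2) / (z.1 + z.1 * z.2) = z.2 / (1 + z.2) * z.1 := by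
      field_simp
    have e2 : (Real.pi / (z.1 * z.2)) ^ h = Real.pi ^ h * z.1 ^ (-h) * z.2 ^ (-h) := by
      rw [Real.div_rpow Real.pi_pos.le (by positivity), Real.mul_rpow ha.le hb.le,
        Real.rpow_neg ha.le, Real.rpow_neg hb.le]
      field_simp
    have e3 : (Real.pi / (z.1 + z.1 * z.2)) ^ h =
        Real.pi ^ h * z.1 ^ (-h) * z.2 ^ (-h) * (z.2 / (1 + z.2)) ^ h := by
      rw [← e2, ← Real.mul_rpow (by positivity) (by positivity)]
      congr 1
      field_simp
    have e4 : (z.1 * z.2) ^ (h + s - 1) = z.1 ^ h * z.1 ^ (s - 1) * (z.2 ^ h * z.2 ^ (s - 1)) := by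
      rw [Real.mul_rpow ha.le hb.le, ← Real.rpow_add ha, ← Real.rpow_add hb]
      ring_nf
    have e5 : z.1 ^ (α + s - 1) = z.1 * z.1 ^ (s - 1) * z.1 ^ (α - 1) := by
      rw [mul_assoc, mul_comm, ← Real.rpow_add ha, ← Real.rpow_add_one ha.ne']
      ring_nf
    rw [e1, e2, e3, e4, e5, Real.rpow_neg ha.le, Real.rpow_neg hb.le, ← mul_assoc R]
    field_simp
  obtain ⟨j1, j2⟩ := integrable_prod_Ioi_of_comp_mul hfm ((k1.const_mul (Real.pi ^ h)).congr hfk)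
  obtain ⟨-, j3⟩ := integrable_prod_Ioi_of_comp_mul (f := fun z => |f z|) hfm.abs
    ((k1.const_mul (Real.pi ^ h)).abs.congr (by
      filter_upwards [hfk, hmem2] with z hz hz2
      rw [hz, abs_mul, abs_of_pos hz2.1]))
  rw [← hP] at j1 j2 j3
  simp only [← integral_const_mul]
  refine ⟨j1.integral_prod_right, ?_, ?_⟩
  · rw [← k2, ← integral_const_mul, integral_congr_ae hfk, ← j2, integral_prod_symm _ j1]
  · calc _ ≤ ∫ b in Ioi (0 : ℝ), ∫ a in Ioi (0 : ℝ), |f (a, b)| :=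
          integral_mono j1.integral_prod_right.abs j1.abs.integral_prod_right
            fun b => abs_integral_le_integral_abs
      _ = ∫ z, Real.pi ^ h * |k z| ∂P := by
          rw [← integral_prod_symm (fun z => |f z|) j1.abs, j3]
          refine integral_congr_ae ?_
          filter_upwards [hfk, hmem2] with z hz hz2
          rw [← abs_of_pos hz2.1, ← abs_mul, abs_of_pos hz2.1, ← hz, abs_mul,
            abs_of_pos (by positivity)]
      _ ≤ _ := by
          rw [integral_const_mul]
          exact mul_le_mul_of_nonneg_left k3 (by positivity)

end TwoDim

section Gaussian

open Set

theorem mul_norm_sub_sq_add_mul_norm_sq {V : Type*} [NormedAddCommGroup V]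
    [InnerProductSpace ℝ V] {a b : ℝ} (hab : a + b ≠ 0) (x y : V) :
    b * ‖x - y‖ ^ 2 + a * ‖y‖ ^ 2 =
      (a + b) * ‖(b / (a + b)) • x - y‖ ^ 2 + ‖x‖ ^ 2 * (a * b / (a + b)) := by
  rw [norm_sub_sq_real, norm_sub_sq_real, norm_smul, real_inner_smul_left, mul_pow,
    Real.norm_eq_abs, sq_abs]
  field_simp
  ring

theorem exp_neg_mul_norm_sub_sq_le {V : Type*} [NormedAddCommGroup V] {b : ℝ} (hb : 0 < b)
    (x y : V) :
    Real.exp (-(b * ‖x - y‖ ^ 2)) ≤ Real.exp (b * ‖x‖ ^ 2) * Real.exp (-(b / 2 * ‖y‖ ^ 2)) := by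
  rw [← Real.exp_add]
  refine Real.exp_le_exp.2 ?_
  have h1 : ‖y‖ ≤ ‖x - y‖ + ‖x‖ := by
    have := norm_sub_le x (x - y)
    rw [sub_sub_cancel] at this
    linarith
  have h2 : ‖y‖ ^ 2 ≤ 2 * ‖x - y‖ ^ 2 + 2 * ‖x‖ ^ 2 := by
    nlinarith [norm_nonneg y, norm_nonneg x, norm_nonneg (x - y), sq_nonneg (‖x - y‖ - ‖x‖)]
  nlinarith

theorem sq_norm_rpow_half {V : Type*} [NormedAddCommGroup V] (x : V) (γ : ℝ) : (‖x‖ ^ 2) ^ (γ / 2) = ‖x‖ ^ γ := by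
  rw [← Real.rpow_natCast, ← Real.rpow_mul (norm_nonneg x)]
  congr 1
  push_cast
  ring

variable {V : Type*} [NormedAddCommGroup V] [InnerProductSpace ℝ V] [FiniteDimensional ℝ V]
  [MeasurableSpace V] [BorelSpace V]

theorem integral_exp_neg_mul_norm_sub_sq {b : ℝ} (hb : 0 < b) (x : V) :
    Integrable (fun y : V => Real.exp (-(b * ‖x - y‖ ^ 2))) ∧
    ∫ y : V, Real.exp (-(b * ‖x - y‖ ^ 2)) = (Real.pi / b) ^ ((Module.finrank ℝ V : ℝ) / 2) := by
  have h : ∫ y : V, Real.exp (-(b * ‖x - y‖ ^ 2)) =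
      (Real.pi / b) ^ ((Module.finrank ℝ V : ℝ) / 2) := by
    rw [integral_sub_left_eq_self (fun y : V => Real.exp (-(b * ‖y‖ ^ 2))) volume x,
      ← GaussianFourier.integral_rexp_neg_mul_sq_norm hb]
    simp only [neg_mul]
  refine ⟨?_, h⟩
  by_contra hn
  rw [integral_undef hn] at h
  have : 0 < (Real.pi / b) ^ ((Module.finrank ℝ V : ℝ) / 2) := by positivity
  linarith

theorem integral_exp_mul_exp_norm_sq {a b : ℝ} (ha : 0 < a) (hb : 0 < b) (x : V) :
    Integrable (fun y : V => Real.exp (-(b * ‖x - y‖ ^ 2)) * Real.exp (-(‖y‖ ^ 2 * a))) ∧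
    ∫ y : V, Real.exp (-(b * ‖x - y‖ ^ 2)) * Real.exp (-(‖y‖ ^ 2 * a)) =
      (Real.pi / (a + b)) ^ ((Module.finrank ℝ V : ℝ) / 2) *
        Real.exp (-(‖x‖ ^ 2 * (a * b / (a + b)))) := by
  have e : (fun y : V => Real.exp (-(b * ‖x - y‖ ^ 2)) * Real.exp (-(‖y‖ ^ 2 * a))) =
      fun y => Real.exp (-((a + b) * ‖(b / (a + b)) • x - y‖ ^ 2)) *
        Real.exp (-(‖x‖ ^ 2 * (a * b / (a + b)))) := by
    ext y
    rw [← Real.exp_add, ← Real.exp_add]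
    have := mul_norm_sub_sq_add_mul_norm_sq (add_pos ha hb).ne' x y
    congr 1
    linarith
  obtain ⟨h1, h2⟩ := integral_exp_neg_mul_norm_sub_sq (add_pos ha hb) ((b / (a + b)) • x)
  rw [e, integral_mul_const, h2]
  exact ⟨h1.mul_const _, rfl⟩

theorem integrable_norm_rpow_mul_exp [Nontrivial V] {γ b : ℝ}
    (hγ : 0 < Module.finrank ℝ V + γ) (hb : 0 < b) :
    Integrable (fun y : V => ‖y‖ ^ γ * Real.exp (-(b * ‖y‖ ^ 2))) := by
  refine (integrable_fun_norm_addHaar volume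
    (f := fun t : ℝ => t ^ γ * Real.exp (-(b * t ^ 2)))).2 ?_
  have h1 := integrableOn_rpow_mul_exp_neg_mul_sq hb
    (s := (Module.finrank ℝ V : ℝ) - 1 + γ) (by linarith)
  refine h1.congr_fun (fun t ht => ?_) measurableSet_Ioi
  have ht : (0 : ℝ) < t := ht
  have hd : 1 ≤ Module.finrank ℝ V := Module.finrank_pos
  simp only [smul_eq_mul]
  rw [Real.rpow_add ht, ← Nat.cast_one (R := ℝ), ← Nat.cast_sub hd, Real.rpow_natCast, neg_mul,
    mul_assoc]

theorem integrable_norm_rpow_mul_exp_sub [Nontrivial V] {γ b : ℝ}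
    (hγ : 0 < Module.finrank ℝ V + γ) (hb : 0 < b) (x : V) :
    Integrable (fun y : V => ‖y‖ ^ γ * Real.exp (-(b * ‖x - y‖ ^ 2))) := by
  refine ((integrable_norm_rpow_mul_exp hγ (half_pos hb)).const_mul
    (Real.exp (b * ‖x‖ ^ 2))).mono' (by fun_prop : Measurable _).aestronglyMeasurable ?_
  filter_upwards with y
  rw [Real.norm_of_nonneg (by positivity), mul_left_comm]
  exact mul_le_mul_of_nonneg_left (exp_neg_mul_norm_sub_sq_le hb x y) (by positivity)

/-- The (unnormalised) Gaussian average of the increments of `‖·‖ ^ γ` around `x`. -/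
noncomputable def gaussianIncrement (γ b : ℝ) (x : V) : ℝ :=
  ∫ y : V, (‖x‖ ^ γ - ‖y‖ ^ γ) * Real.exp (-(b * ‖x - y‖ ^ 2))

theorem Gamma_mul_gaussianIncrement [Nontrivial V] {γ b : ℝ} (hγ0 : γ ≠ 0) (hγ2 : γ < 2)
    (hγ : 0 < Module.finrank ℝ V + γ) (hb : 0 < b) {x : V} (hx : x ≠ 0) :
    Real.Gamma (-γ / 2) * gaussianIncrement γ b x =
      ∫ a in Ioi (0 : ℝ), a ^ (-γ / 2 - 1) *
        ((Real.pi / b) ^ ((Module.finrank ℝ V : ℝ) / 2) * Real.exp (-(‖x‖ ^ 2 * a)) -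
        (Real.pi / (a + b)) ^ ((Module.finrank ℝ V : ℝ) / 2) *
          Real.exp (-(‖x‖ ^ 2 * (a * b / (a + b))))) := by
  have hα : -1 < -γ / 2 := by linarith
  have hα0 : -γ / 2 ≠ 0 := by
    contrapose! hγ0; linarith
  have hx2 : 0 < ‖x‖ ^ 2 := pow_pos (norm_pos_iff.2 hx) 2
  have hne : ∀ᵐ y : V, y ≠ 0 := by
    simp [ae_iff]
  set f : V × ℝ → ℝ := fun z => Real.exp (-(b * ‖x - z.1‖ ^ 2)) * (z.2 ^ (-γ / 2 - 1) *
    (Real.exp (-(‖x‖ ^ 2 * z.2)) - Real.exp (-(‖z.1‖ ^ 2 * z.2)))) with hf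
  have hfm : Measurable f := by fun_prop
  have hrp : ∀ y : V, (‖y‖ ^ 2) ^ (-(-γ / 2)) = ‖y‖ ^ γ := fun y => by
    rw [← sq_norm_rpow_half]; ring_nf
  have hinc : Integrable
      (fun y : V => (‖x‖ ^ γ - ‖y‖ ^ γ) * Real.exp (-(b * ‖x - y‖ ^ 2))) := by
    simp only [sub_mul]
    exact ((integral_exp_neg_mul_norm_sub_sq hb x).1.const_mul _).sub
      (integrable_norm_rpow_mul_exp_sub hγ hb x)
  have hfi : Integrable f (volume.prod (volume.restrict (Ioi (0 : ℝ)))) := by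
    refine (integrable_prod_iff hfm.aestronglyMeasurable).2 ⟨?_, ?_⟩
    · filter_upwards [hne] with y hy
      exact (integral_rpow_mul_exp_sub_exp hα hα0 hx2
        (pow_pos (norm_pos_iff.2 hy) 2)).1.const_mul
        (Real.exp (-(b * ‖x - y‖ ^ 2)))
    · refine (hinc.const_mul (Real.Gamma (-γ / 2))).abs.congr ?_
      filter_upwards [hne] with y hy
      simp only [hf, norm_mul (Real.exp _)]
      rw [integral_const_mul]
      simp only [Real.norm_eq_abs]
      rw [integral_abs_rpow_mul_exp_sub_exp hα hα0 hx2
        (pow_pos (norm_pos_iff.2 hy) 2), hrp, hrp, ← abs_mul]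
      congr 1
      ring
  calc _ = ∫ y : V, ∫ a in Ioi (0 : ℝ), f (y, a) := by
        rw [gaussianIncrement, ← integral_const_mul]
        refine integral_congr_ae ?_
        filter_upwards [hne] with y hy
        simp only [hf]
        rw [integral_const_mul,
          (integral_rpow_mul_exp_sub_exp hα hα0 hx2
        (pow_pos (norm_pos_iff.2 hy) 2)).2, hrp, hrp]
        ring
    _ = ∫ a in Ioi (0 : ℝ), ∫ y : V, f (y, a) :=
        integral_integral_swap (f := fun y a => f (y, a)) hfi
    _ = _ := by
        refine setIntegral_congr_fun measurableSet_Ioi fun a ha => ?_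
        have ha : (0 : ℝ) < a := ha
        obtain ⟨i1, e1⟩ := integral_exp_neg_mul_norm_sub_sq hb x
        obtain ⟨i2, e2⟩ := integral_exp_mul_exp_norm_sq ha hb x
        have e : (fun y : V => f (y, a)) = fun y => a ^ (-γ / 2 - 1) *
            (Real.exp (-(b * ‖x - y‖ ^ 2)) * Real.exp (-(‖x‖ ^ 2 * a)) -
              Real.exp (-(b * ‖x - y‖ ^ 2)) * Real.exp (-(‖y‖ ^ 2 * a))) := by
          ext y; simp only [hf]; ring
        simp only [e]
        rw [integral_const_mul, integral_sub (i1.mul_const _) i2, integral_mul_const, e1, e2]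

theorem Gamma_neg_half_ne_zero {γ : ℝ} (hγ0 : γ ≠ 0) (hγ2 : γ < 2) : Real.Gamma (-γ / 2) ≠ 0 := by
  refine Real.Gamma_ne_zero fun m hm => ?_
  rcases Nat.eq_zero_or_pos m with rfl | h
  · apply hγ0
    simp only [Nat.cast_zero] at hm
    linarith
  · have : (1 : ℝ) ≤ m := by exact_mod_cast h
    linarith

/-- The pointwise action of the fractional Laplacian on `‖·‖ ^ γ`, in subordinated form. -/
theorem integral_rpow_mul_gaussianIncrement [Nontrivial V] {s γ : ℝ} (hs : 0 < s) (hs1 : s < 1)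
    (hγ0 : γ ≠ 0) (hγs : γ < 2 * s) (hγ : 2 * s < Module.finrank ℝ V + γ) :
    ∃ c : ℝ, ∀ x : V, x ≠ 0 →
      Integrable (fun b : ℝ => b ^ ((Module.finrank ℝ V : ℝ) / 2 + s - 1) *
        gaussianIncrement γ b x) (volume.restrict (Ioi (0 : ℝ))) ∧
      ∫ b in Ioi (0 : ℝ), b ^ ((Module.finrank ℝ V : ℝ) / 2 + s - 1) * gaussianIncrement γ b x =
        Real.pi ^ ((Module.finrank ℝ V : ℝ) / 2) * Real.Gamma ((2 * s - γ) / 2) *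
          Real.Gamma ((Module.finrank ℝ V + γ) / 2) * Real.Gamma (1 - s) /
          (s * Real.Gamma (-γ / 2) * Real.Gamma ((Module.finrank ℝ V + γ - 2 * s) / 2)) *
          ‖x‖ ^ (γ - 2 * s) ∧
      ∫ b in Ioi (0 : ℝ), |b ^ ((Module.finrank ℝ V : ℝ) / 2 + s - 1) *
        gaussianIncrement γ b x| ≤ c * ‖x‖ ^ (γ - 2 * s) := by
  set d : ℝ := ((Module.finrank ℝ V : ℕ) : ℝ) with hd
  have hΓ := Gamma_neg_half_ne_zero hγ0 (by linarith)
  refine ⟨|(Real.Gamma (-γ / 2))⁻¹| * (Real.pi ^ (d / 2) * (Real.Gamma (-γ / 2 + s) *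
        (2 * (Real.Gamma (d / 2 + s) * Real.Gamma (1 - s) / (s * Real.Gamma (d / 2))) -
        (Real.Gamma (d / 2 - -γ / 2) * Real.Gamma (1 - s) /
          (s * Real.Gamma (d / 2 - (-γ / 2 + s))))))), fun x hx => ?_⟩
  have hx2 : 0 < ‖x‖ ^ 2 := pow_pos (norm_pos_iff.2 hx) 2
  obtain ⟨h1, h2, h3⟩ := integrable_subordinated_difference (α := -γ / 2) (h := d / 2) hs hs1
    (by linarith) (by linarith) hx2
  have hR : (‖x‖ ^ 2) ^ (-(-γ / 2 + s)) = ‖x‖ ^ (γ - 2 * s) := by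
    rw [← sq_norm_rpow_half]; ring_nf
  have he : ∀ b ∈ Ioi (0 : ℝ), b ^ (d / 2 + s - 1) * gaussianIncrement γ b x =
      (Real.Gamma (-γ / 2))⁻¹ * (b ^ (d / 2 + s - 1) * ∫ a in Ioi (0 : ℝ), a ^ (-γ / 2 - 1) *
      ((Real.pi / b) ^ (d / 2) * Real.exp (-(‖x‖ ^ 2 * a)) -
        (Real.pi / (a + b)) ^ (d / 2) * Real.exp (-(‖x‖ ^ 2 * (a * b / (a + b)))))) := by
    intro b hb
    rw [← Gamma_mul_gaussianIncrement hγ0 (by linarith) (by linarith) hb hx,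
      mul_left_comm (b ^ (d / 2 + s - 1)), inv_mul_cancel_left₀ hΓ]
  rw [hR] at h2 h3
  refine ⟨?_, ?_, ?_⟩
  · exact IntegrableOn.congr_fun (h1.const_mul _) (fun b hb => (he b hb).symm) measurableSet_Ioi
  · rw [setIntegral_congr_fun measurableSet_Ioi he, integral_const_mul, h2,
      show -γ / 2 + s = (2 * s - γ) / 2 by ring, show d / 2 - -γ / 2 = (d + γ) / 2 by ring,
      show d / 2 - (2 * s - γ) / 2 = (d + γ - 2 * s) / 2 by ring]
    field_simp
  · rw [setIntegral_congr_fun measurableSet_Ioi fun b hb => congrArg abs (he b hb)]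
    simp only [abs_mul (Real.Gamma (-γ / 2))⁻¹]
    rw [integral_const_mul]
    refine (mul_le_mul_of_nonneg_left h3 (abs_nonneg _)).trans_eq ?_
    ring

end Gaussian

section GroundState

open Set

variable {V : Type*} [NormedAddCommGroup V] [InnerProductSpace ℝ V] [FiniteDimensional ℝ V]
  [MeasurableSpace V] [BorelSpace V]

theorem integrable_fst_mul_exp_norm_sub_sq {φ : V → ℝ} (hφ : Integrable φ) {c : ℝ} (hc : 0 < c) :
    Integrable (fun z : V × V => φ z.1 * Real.exp (-(c * ‖z.1 - z.2‖ ^ 2)))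
      (volume.prod volume) ∧
    ∫ z : V × V, φ z.1 * Real.exp (-(c * ‖z.1 - z.2‖ ^ 2)) ∂(volume.prod volume) =
      (∫ x, φ x) * (Real.pi / c) ^ ((Module.finrank ℝ V : ℝ) / 2) := by
  have hm : AEStronglyMeasurable (fun z : V × V => φ z.1 * Real.exp (-(c * ‖z.1 - z.2‖ ^ 2)))
      (volume.prod volume) :=
    hφ.1.comp_fst.mul (by fun_prop : Measurable _).aestronglyMeasurable
  have hi : Integrable (fun z : V × V => φ z.1 * Real.exp (-(c * ‖z.1 - z.2‖ ^ 2)))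
      (volume.prod volume) := by
    refine (integrable_prod_iff hm).2 ⟨?_, ?_⟩
    · filter_upwards with x
      exact (integral_exp_neg_mul_norm_sub_sq hc x).1.const_mul _
    · simp only [norm_mul, Real.norm_eq_abs, Real.abs_exp, integral_const_mul,
        (integral_exp_neg_mul_norm_sub_sq hc _).2]
      exact hφ.abs.mul_const _
  refine ⟨hi, ?_⟩
  rw [integral_prod _ hi]
  simp only [integral_const_mul, (integral_exp_neg_mul_norm_sub_sq hc _).2]
  rw [integral_mul_const]

theorem integrable_add_mul_exp_norm_sub_sq {φ : V → ℝ} (hφ : Integrable φ) {c : ℝ} (hc : 0 < c) :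
    Integrable (fun z : V × V => (φ z.1 + φ z.2) * Real.exp (-(c * ‖z.1 - z.2‖ ^ 2)))
      (volume.prod volume) ∧
    ∫ z : V × V, (φ z.1 + φ z.2) * Real.exp (-(c * ‖z.1 - z.2‖ ^ 2)) ∂(volume.prod volume) =
      2 * (∫ x, φ x) * (Real.pi / c) ^ ((Module.finrank ℝ V : ℝ) / 2) := by
  obtain ⟨h1, h2⟩ := integrable_fst_mul_exp_norm_sub_sq hφ hc
  have e : ∀ z : V × V, φ z.2 * Real.exp (-(c * ‖z.1 - z.2‖ ^ 2)) =
      φ z.swap.1 * Real.exp (-(c * ‖z.swap.1 - z.swap.2‖ ^ 2)) := by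
    intro z
    simp [norm_sub_rev z.1 z.2]
  have h3 : Integrable (fun z : V × V => φ z.2 * Real.exp (-(c * ‖z.1 - z.2‖ ^ 2)))
      (volume.prod volume) := by
    simp only [e]
    exact h1.swap
  simp only [add_mul]
  refine ⟨h1.add h3, ?_⟩
  rw [integral_add h1 h3, h2]
  simp only [e]
  rw [integral_prod_swap (fun z : V × V => φ z.1 * Real.exp (-(c * ‖z.1 - z.2‖ ^ 2))), h2]
  ring

theorem mul_sq_mul_exp_neg_le {b t : ℝ} (hb : 0 < b) :
    t ^ 2 * Real.exp (-(b * t ^ 2)) ≤ 2 / b * Real.exp (-(b / 2 * t ^ 2)) := by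
  have h1 : b / 2 * t ^ 2 * Real.exp (-(b / 2 * t ^ 2)) ≤ 1 := by
    rw [Real.exp_neg, ← div_eq_mul_inv, div_le_one (Real.exp_pos _)]
    linarith [Real.add_one_le_exp (b / 2 * t ^ 2)]
  have h2 : Real.exp (-(b * t ^ 2)) =
      Real.exp (-(b / 2 * t ^ 2)) * Real.exp (-(b / 2 * t ^ 2)) := by
    rw [← Real.exp_add]; ring_nf
  have h3 := mul_le_mul_of_nonneg_right h1 (Real.exp_pos (-(b / 2 * t ^ 2))).le
  have h4 := mul_le_mul_of_nonneg_left h3 (by positivity : 0 ≤ 2 / b)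
  rw [h2]
  calc _ = 2 / b * (b / 2 * t ^ 2 * Real.exp (-(b / 2 * t ^ 2)) *
        Real.exp (-(b / 2 * t ^ 2))) := by field_simp
    _ ≤ _ := by rwa [one_mul] at h4

theorem integrable_sq_sub_mul_exp {u : V → ℝ} (hu : Continuous u) (hc : HasCompactSupport u)
    {b : ℝ} (hb : 0 < b) :
    Integrable (fun z : V × V => (u z.1 - u z.2) ^ 2 * Real.exp (-(b * ‖z.1 - z.2‖ ^ 2)))
      (volume.prod volume) ∧
    ∫ z : V × V, (u z.1 - u z.2) ^ 2 * Real.exp (-(b * ‖z.1 - z.2‖ ^ 2)) ∂(volume.prod volume) ≤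
      2 * (∫ x, 2 * u x ^ 2) * (Real.pi / b) ^ ((Module.finrank ℝ V : ℝ) / 2) := by
  have hφ : Integrable (fun x => 2 * u x ^ 2) := by
    refine Continuous.integrable_of_hasCompactSupport (by fun_prop) ?_
    exact hc.comp_left (g := fun t : ℝ => 2 * t ^ 2) (by simp)
  obtain ⟨h1, h2⟩ := integrable_add_mul_exp_norm_sub_sq hφ hb
  have hle : ∀ z : V × V, (u z.1 - u z.2) ^ 2 * Real.exp (-(b * ‖z.1 - z.2‖ ^ 2)) ≤
      (2 * u z.1 ^ 2 + 2 * u z.2 ^ 2) * Real.exp (-(b * ‖z.1 - z.2‖ ^ 2)) := by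
    intro z
    refine mul_le_mul_of_nonneg_right ?_ (Real.exp_pos _).le
    nlinarith [sq_nonneg (u z.1 + u z.2)]
  have hi : Integrable
      (fun z : V × V => (u z.1 - u z.2) ^ 2 * Real.exp (-(b * ‖z.1 - z.2‖ ^ 2)))
      (volume.prod volume) := by
    refine h1.mono' (by fun_prop : Continuous _).measurable.aestronglyMeasurable ?_
    filter_upwards with z
    rw [Real.norm_of_nonneg (by positivity)]
    exact hle z
  exact ⟨hi, (integral_mono hi h1 hle).trans_eq h2⟩

theorem integral_sq_sub_mul_exp_le_of_lipschitz {u : V → ℝ} {L : NNReal} (hL : LipschitzWith L u)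
    (hc : HasCompactSupport u) {b : ℝ} (hb : 0 < b) :
    ∫ z : V × V, (u z.1 - u z.2) ^ 2 * Real.exp (-(b * ‖z.1 - z.2‖ ^ 2)) ∂(volume.prod volume) ≤
      L ^ 2 * (2 / b) * (2 * (volume.real (tsupport u)) *
        (Real.pi / (b / 2)) ^ ((Module.finrank ℝ V : ℝ) / 2)) := by
  have hS : MeasurableSet (tsupport u) := (isClosed_tsupport u).measurableSet
  have hφ : Integrable ((tsupport u).indicator fun _ : V => (1 : ℝ)) :=
    (integrable_indicator_iff hS).2 (integrableOn_const hc.measure_lt_top.ne)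
  obtain ⟨h1, h2⟩ := integrable_add_mul_exp_norm_sub_sq hφ (half_pos hb)
  rw [integral_indicator_const _ hS, smul_eq_mul, mul_one] at h2
  rw [← h2, ← integral_const_mul]
  refine integral_mono (integrable_sq_sub_mul_exp hL.continuous hc hb).1 (h1.const_mul _)
    fun z => ?_
  have hlip : (u z.1 - u z.2) ^ 2 ≤ L ^ 2 * ‖z.1 - z.2‖ ^ 2 := by
    rw [← mul_pow, ← sq_abs, ← Real.norm_eq_abs]
    exact pow_le_pow_left₀ (norm_nonneg _) (hL.norm_sub_le _ _) 2
  have hind : ∀ x : V, 0 ≤ (tsupport u).indicator (fun _ : V => (1 : ℝ)) x :=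
    fun x => indicator_apply_nonneg fun _ => zero_le_one
  by_cases hz : z.1 ∈ tsupport u ∨ z.2 ∈ tsupport u
  · have h5 : 1 ≤ (tsupport u).indicator (fun _ : V => (1 : ℝ)) z.1 +
        (tsupport u).indicator (fun _ : V => (1 : ℝ)) z.2 := by
      rcases hz with h | h
      · rw [indicator_of_mem h]; linarith [hind z.2]
      · rw [indicator_of_mem h]; linarith [hind z.1]
    calc _ ≤ L ^ 2 * ‖z.1 - z.2‖ ^ 2 * Real.exp (-(b * ‖z.1 - z.2‖ ^ 2)) :=
          mul_le_mul_of_nonneg_right hlip (Real.exp_pos _).le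
      _ = L ^ 2 * (‖z.1 - z.2‖ ^ 2 * Real.exp (-(b * ‖z.1 - z.2‖ ^ 2))) := by ring
      _ ≤ L ^ 2 * (2 / b * Real.exp (-(b / 2 * ‖z.1 - z.2‖ ^ 2))) := by
          exact mul_le_mul_of_nonneg_left (mul_sq_mul_exp_neg_le hb) (by positivity)
      _ = L ^ 2 * (2 / b) * (1 * Real.exp (-(b / 2 * ‖z.1 - z.2‖ ^ 2))) := by ring
      _ ≤ _ := by gcongr
  · push Not at hz
    simp only [image_eq_zero_of_notMem_tsupport hz.1, image_eq_zero_of_notMem_tsupport hz.2]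
    rw [sub_self, zero_pow two_ne_zero, zero_mul]
    have := hind z.1
    have := hind z.2
    positivity

theorem integrable_rpow_mul_integral_sq_sub_mul_exp {u : V → ℝ} {L : NNReal}
    (hL : LipschitzWith L u) (hc : HasCompactSupport u) {s : ℝ} (hs : 0 < s) (hs1 : s < 1) :
    Integrable (fun b : ℝ => b ^ ((Module.finrank ℝ V : ℝ) / 2 + s - 1) *
      ∫ z : V × V, (u z.1 - u z.2) ^ 2 * Real.exp (-(b * ‖z.1 - z.2‖ ^ 2)) ∂(volume.prod volume))
      (volume.restrict (Ioi (0 : ℝ))) := by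
  have hu := hL.continuous
  set h : ℝ := ((Module.finrank ℝ V : ℕ) : ℝ) / 2 with hh
  have hm : StronglyMeasurable (fun b : ℝ => b ^ (h + s - 1) *
      ∫ z : V × V, (u z.1 - u z.2) ^ 2 * Real.exp (-(b * ‖z.1 - z.2‖ ^ 2))
        ∂(volume.prod volume)) := by
    refine (by fun_prop : Measurable fun b : ℝ => b ^ (h + s - 1)).stronglyMeasurable.mul ?_
    refine StronglyMeasurable.integral_prod_right (f := fun (b : ℝ) (z : V × V) =>
      (u z.1 - u z.2) ^ 2 * Real.exp (-(b * ‖z.1 - z.2‖ ^ 2))) ?_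
    exact (by fun_prop : Continuous fun p : ℝ × (V × V) =>
      (u p.2.1 - u p.2.2) ^ 2 *
        Real.exp (-(p.1 * ‖p.2.1 - p.2.2‖ ^ 2))).measurable.stronglyMeasurable
  have h0 : ∀ b : ℝ, 0 < b → ‖b ^ (h + s - 1) *
      ∫ z : V × V, (u z.1 - u z.2) ^ 2 * Real.exp (-(b * ‖z.1 - z.2‖ ^ 2))
        ∂(volume.prod volume)‖ = b ^ (h + s - 1) *
      ∫ z : V × V, (u z.1 - u z.2) ^ 2 * Real.exp (-(b * ‖z.1 - z.2‖ ^ 2))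
        ∂(volume.prod volume) := fun b hb =>
    Real.norm_of_nonneg (mul_nonneg (by positivity) (integral_nonneg fun z => by positivity))
  have hpow : ∀ b : ℝ, 0 < b → b ^ (h + s - 1) = b ^ h * b ^ (s - 1) := fun b hb => by
    rw [← Real.rpow_add hb]; ring_nf
  change IntegrableOn _ (Ioi (0 : ℝ)) _
  rw [← Ioc_union_Ioi_eq_Ioi zero_le_one]
  refine IntegrableOn.union ?_ ?_
  · have hi : IntegrableOn (fun b : ℝ => 2 * (∫ x, 2 * u x ^ 2) * Real.pi ^ h * b ^ (s - 1))
        (Ioc 0 1) := by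
      refine Integrable.const_mul ?_ _
      have := (integral_Ioo_rpow_sub_one hs one_pos).1
      rwa [← integrableOn_Ioc_iff_integrableOn_Ioo] at this
    refine Integrable.mono' hi hm.aestronglyMeasurable ?_
    filter_upwards [ae_restrict_mem measurableSet_Ioc] with b hb
    have hb0 := hb.1
    rw [h0 b hb0]
    refine (mul_le_mul_of_nonneg_left (integrable_sq_sub_mul_exp hu hc hb0).2
      (by positivity)).trans_eq ?_
    rw [hpow b hb0, ← hh, Real.div_rpow Real.pi_pos.le hb0.le]
    field_simp
  · have hi : IntegrableOn (fun b : ℝ => L ^ 2 * 2 * (2 * (volume.real (tsupport u)) *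
        (2 * Real.pi) ^ h) * b ^ (s - 1 - 1)) (Ioi 1) :=
      (integrableOn_Ioi_rpow_of_lt (by linarith) one_pos).const_mul _
    refine Integrable.mono' hi hm.aestronglyMeasurable ?_
    filter_upwards [ae_restrict_mem measurableSet_Ioi] with b hb
    have hb0 : 0 < b := one_pos.trans hb
    rw [h0 b hb0]
    refine (mul_le_mul_of_nonneg_left (integral_sq_sub_mul_exp_le_of_lipschitz hL hc hb0)
      (by positivity)).trans_eq ?_
    rw [hpow b hb0, ← hh, show Real.pi / (b / 2) = 2 * Real.pi / b by field_simp,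
      Real.div_rpow (by positivity) hb0.le, Real.rpow_sub_one hb0.ne' (s - 1)]
    field_simp

/-- Subordination of the kernel `‖x - y‖ ^ (-(d + 2 s))` to Gaussians. -/
theorem integrable_mul_norm_sub_rpow_of_gaussian {A : V × V → ℝ} (hA : Measurable A)
    (hA0 : ∀ z, 0 ≤ A z) (hAd : ∀ x, A (x, x) = 0) {s : ℝ} (hs : 0 < s)
    (h1 : ∀ b : ℝ, 0 < b → Integrable (fun z : V × V => A z * Real.exp (-(b * ‖z.1 - z.2‖ ^ 2)))
      (volume.prod volume))
    (h2 : Integrable (fun b : ℝ => b ^ ((Module.finrank ℝ V : ℝ) / 2 + s - 1) *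
      ∫ z : V × V, A z * Real.exp (-(b * ‖z.1 - z.2‖ ^ 2)) ∂(volume.prod volume))
      (volume.restrict (Ioi (0 : ℝ)))) :
    Integrable (fun z : V × V => A z * ‖z.1 - z.2‖ ^ (-((Module.finrank ℝ V : ℝ) + 2 * s)))
      (volume.prod volume) ∧
    Real.Gamma ((Module.finrank ℝ V + 2 * s) / 2) *
      ∫ z : V × V, A z * ‖z.1 - z.2‖ ^ (-((Module.finrank ℝ V : ℝ) + 2 * s))
        ∂(volume.prod volume) =
    ∫ b in Ioi (0 : ℝ), b ^ ((Module.finrank ℝ V : ℝ) / 2 + s - 1) *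
      ∫ z : V × V, A z * Real.exp (-(b * ‖z.1 - z.2‖ ^ 2)) ∂(volume.prod volume) := by
  set d : ℝ := ((Module.finrank ℝ V : ℕ) : ℝ) with hd
  have hd0 : 0 ≤ d := Nat.cast_nonneg _
  have hΓ : Real.Gamma ((d + 2 * s) / 2) ≠ 0 := (Real.Gamma_pos_of_pos (by linarith)).ne'
  have hmem : ∀ᵐ b ∂(volume.restrict (Ioi (0 : ℝ))), b ∈ Ioi (0 : ℝ) :=
    ae_restrict_mem measurableSet_Ioi
  have key := integrable_and_integral_eq_of_slices (μ := (volume : Measure V).prod volume)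
    (ν := volume.restrict (Ioi (0 : ℝ)))
    (f := fun p : (V × V) × ℝ => p.2 ^ (d / 2 + s - 1) *
      (A p.1 * Real.exp (-(p.2 * ‖p.1.1 - p.1.2‖ ^ 2))))
    (F := fun z : V × V => Real.Gamma ((d + 2 * s) / 2) * (A z * ‖z.1 - z.2‖ ^ (-(d + 2 * s))))
    (G := fun b : ℝ => b ^ (d / 2 + s - 1) *
      ∫ z : V × V, A z * Real.exp (-(b * ‖z.1 - z.2‖ ^ 2)) ∂(volume.prod volume))
    ?_ ?_ ?_ ?_ h2 ?_
  · rw [integral_const_mul] at key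
    exact ⟨(integrable_const_mul_iff (isUnit_iff_ne_zero.2 hΓ) _).1 key.1, key.2⟩
  · exact (by fun_prop : Measurable _).aestronglyMeasurable
  · filter_upwards [hmem] with b hb
    filter_upwards with z
    have hb : (0 : ℝ) < b := hb
    have := hA0 z
    positivity
  · filter_upwards [hmem] with b hb
    exact (h1 b hb).const_mul (b ^ (d / 2 + s - 1))
  · filter_upwards with b
    rw [integral_const_mul]
  · filter_upwards with z
    by_cases hz : z.1 = z.2
    · have : A z = 0 := by
        rw [← hAd z.1]
        congr 1
        exact Prod.ext rfl hz.symm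
      simp [this]
    · have hz0 : 0 < ‖z.1 - z.2‖ := norm_pos_iff.2 (sub_ne_zero.2 hz)
      have e : ∀ b : ℝ, b ^ (d / 2 + s - 1) * (A z * Real.exp (-(b * ‖z.1 - z.2‖ ^ 2))) =
          A z * (b ^ (d / 2 + s - 1) * Real.exp (-(‖z.1 - z.2‖ ^ 2 * b))) := fun b => by
        rw [mul_comm b (‖z.1 - z.2‖ ^ 2)]; ring
      simp only [e]
      rw [integral_const_mul, integral_rpow_mul_exp_neg_mul_Ioi' (by positivity) (by positivity),
        ← sq_norm_rpow_half (z.1 - z.2) (-(d + 2 * s)),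
        show -(d + 2 * s) / 2 = -(d / 2 + s) by ring, show (d + 2 * s) / 2 = d / 2 + s by ring]
      ring

theorem integrable_sq_mul_norm_rpow {u : V → ℝ} (hu : Continuous u) (hc : HasCompactSupport u)
    (hu0 : (0 : V) ∉ tsupport u) (τ c : ℝ) :
    Integrable (fun x => u x ^ 2 * ‖x‖ ^ τ * Real.exp (c * ‖x‖ ^ 2)) := by
  refine Continuous.integrable_of_hasCompactSupport ?_ ?_
  · refine continuous_iff_continuousAt.2 fun x => ?_
    by_cases hx : x = 0
    · subst hx
      have h : (fun x => u x ^ 2 * ‖x‖ ^ τ * Real.exp (c * ‖x‖ ^ 2)) =ᶠ[nhds 0] fun _ => 0 := by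
        filter_upwards [notMem_tsupport_iff_eventuallyEq.1 hu0] with x hx
        simp [hx]
      exact continuousAt_const.congr h.symm
    · refine ((hu.continuousAt.pow 2).mul ?_).mul (by fun_prop)
      exact continuous_norm.continuousAt.rpow_const (Or.inl (norm_ne_zero_iff.2 hx))
  · refine HasCompactSupport.mul_right (HasCompactSupport.mul_right ?_)
    exact hc.comp_left (g := fun t : ℝ => t ^ 2) (by simp)

theorem integrable_sq_mul_rpow_sub_rpow_mul_exp [Nontrivial V] {u : V → ℝ} (hu : Continuous u)
    (hc : HasCompactSupport u) (hu0 : (0 : V) ∉ tsupport u) {γ b : ℝ}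
    (hγ : 0 < Module.finrank ℝ V + γ) (hb : 0 < b) :
    Integrable (fun z : V × V => u z.1 ^ 2 * ‖z.1‖ ^ (-γ) *
      ((‖z.1‖ ^ γ - ‖z.2‖ ^ γ) * Real.exp (-(b * ‖z.1 - z.2‖ ^ 2)))) (volume.prod volume) ∧
    ∫ z : V × V, u z.1 ^ 2 * ‖z.1‖ ^ (-γ) *
      ((‖z.1‖ ^ γ - ‖z.2‖ ^ γ) * Real.exp (-(b * ‖z.1 - z.2‖ ^ 2))) ∂(volume.prod volume) =
      ∫ x, u x ^ 2 * ‖x‖ ^ (-γ) * gaussianIncrement γ b x := by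
  have hm := hu.measurable
  have h1 : Integrable (fun z : V × V => u z.1 ^ 2 * Real.exp (-(b * ‖z.1 - z.2‖ ^ 2)))
      (volume.prod volume) := by
    refine (integrable_fst_mul_exp_norm_sub_sq (φ := fun x => u x ^ 2) ?_ hb).1
    simpa using integrable_sq_mul_norm_rpow hu hc hu0 0 0
  have h2 : Integrable (fun z : V × V => u z.1 ^ 2 * ‖z.1‖ ^ (-γ) *
      (‖z.2‖ ^ γ * Real.exp (-(b * ‖z.1 - z.2‖ ^ 2)))) (volume.prod volume) := by
    refine ((integrable_sq_mul_norm_rpow hu hc hu0 (-γ) b).mul_prod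
      (integrable_norm_rpow_mul_exp (V := V) hγ (half_pos hb))).mono'
      (by fun_prop : Measurable _).aestronglyMeasurable ?_
    filter_upwards with z
    rw [Real.norm_of_nonneg (by positivity)]
    calc _ ≤ u z.1 ^ 2 * ‖z.1‖ ^ (-γ) * (‖z.2‖ ^ γ *
          (Real.exp (b * ‖z.1‖ ^ 2) * Real.exp (-(b / 2 * ‖z.2‖ ^ 2)))) := by
          refine mul_le_mul_of_nonneg_left (mul_le_mul_of_nonneg_left ?_ (by positivity))
            (by positivity)
          exact exp_neg_mul_norm_sub_sq_le hb z.1 z.2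
      _ = _ := by ring
  have hi : Integrable (fun z : V × V => u z.1 ^ 2 * ‖z.1‖ ^ (-γ) *
      ((‖z.1‖ ^ γ - ‖z.2‖ ^ γ) * Real.exp (-(b * ‖z.1 - z.2‖ ^ 2)))) (volume.prod volume) := by
    refine (h1.sub h2).congr ?_
    filter_upwards with z
    have h0 : u z.1 ^ 2 * ‖z.1‖ ^ (-γ) * ‖z.1‖ ^ γ = u z.1 ^ 2 := by
      by_cases hz : z.1 = 0
      · simp [hz, image_eq_zero_of_notMem_tsupport hu0]
      · rw [mul_assoc, ← Real.rpow_add (norm_pos_iff.2 hz)]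
        simp
    simp only [Pi.sub_apply]
    linear_combination -Real.exp (-(b * ‖z.1 - z.2‖ ^ 2)) * h0
  refine ⟨hi, ?_⟩
  rw [integral_prod _ hi]
  simp only [integral_const_mul, gaussianIncrement]

theorem weighted_sq_sub_eq {V : Type*} [NormedAddCommGroup V] {u : V → ℝ} (hu0 : u 0 = 0) {γ : ℝ} (hγ0 : γ ≠ 0) (x y : V) :
    (‖x‖ ^ (-γ) * u x - ‖y‖ ^ (-γ) * u y) ^ 2 * ‖y‖ ^ γ * ‖x‖ ^ γ =
      (u x - u y) ^ 2 - u x ^ 2 * ‖x‖ ^ (-γ) * (‖x‖ ^ γ - ‖y‖ ^ γ) -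
        u y ^ 2 * ‖y‖ ^ (-γ) * (‖y‖ ^ γ - ‖x‖ ^ γ) := by
  have key : ∀ x : V, x ≠ 0 → ‖x‖ ^ (-γ) = (‖x‖ ^ γ)⁻¹ ∧ ‖x‖ ^ γ ≠ 0 := fun x hx =>
    ⟨Real.rpow_neg (norm_nonneg _) _, (Real.rpow_pos_of_pos (norm_pos_iff.2 hx) _).ne'⟩
  by_cases hx : x = 0
  · subst hx
    by_cases hy : y = 0
    · simp [hy, hu0]
    · obtain ⟨h1, h2⟩ := key y hy
      simp [hu0, Real.zero_rpow hγ0, h1, h2]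
  · obtain ⟨h1, h2⟩ := key x hx
    by_cases hy : y = 0
    · simp [hy, hu0, Real.zero_rpow hγ0, h1, h2]
    · obtain ⟨h3, h4⟩ := key y hy
      rw [h1, h3]
      field_simp
      ring

theorem integral_weighted_sq_sub_mul_exp [Nontrivial V] {u : V → ℝ} (hu : Continuous u)
    (hc : HasCompactSupport u) (hu0 : (0 : V) ∉ tsupport u) {γ b : ℝ} (hγ0 : γ ≠ 0)
    (hγ : 0 < Module.finrank ℝ V + γ) (hb : 0 < b) :
    Integrable (fun z : V × V =>
      (‖z.1‖ ^ (-γ) * u z.1 - ‖z.2‖ ^ (-γ) * u z.2) ^ 2 * ‖z.2‖ ^ γ * ‖z.1‖ ^ γ *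
        Real.exp (-(b * ‖z.1 - z.2‖ ^ 2))) (volume.prod volume) ∧
    ∫ z : V × V, (‖z.1‖ ^ (-γ) * u z.1 - ‖z.2‖ ^ (-γ) * u z.2) ^ 2 * ‖z.2‖ ^ γ * ‖z.1‖ ^ γ *
        Real.exp (-(b * ‖z.1 - z.2‖ ^ 2)) ∂(volume.prod volume) =
      ∫ z : V × V, (u z.1 - u z.2) ^ 2 * Real.exp (-(b * ‖z.1 - z.2‖ ^ 2))
        ∂(volume.prod volume) -
      2 * ∫ x, u x ^ 2 * ‖x‖ ^ (-γ) * gaussianIncrement γ b x := by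
  set D : V × V → ℝ := fun z => u z.1 ^ 2 * ‖z.1‖ ^ (-γ) *
    ((‖z.1‖ ^ γ - ‖z.2‖ ^ γ) * Real.exp (-(b * ‖z.1 - z.2‖ ^ 2))) with hD
  obtain ⟨hi, he⟩ := integrable_sq_mul_rpow_sub_rpow_mul_exp hu hc hu0 hγ hb
  have hE := (integrable_sq_sub_mul_exp hu hc hb).1
  have hfun : (fun z : V × V =>
      (‖z.1‖ ^ (-γ) * u z.1 - ‖z.2‖ ^ (-γ) * u z.2) ^ 2 * ‖z.2‖ ^ γ * ‖z.1‖ ^ γ *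
        Real.exp (-(b * ‖z.1 - z.2‖ ^ 2))) = fun z =>
      (u z.1 - u z.2) ^ 2 * Real.exp (-(b * ‖z.1 - z.2‖ ^ 2)) - D z - D z.swap := by
    funext z
    rw [weighted_sq_sub_eq (image_eq_zero_of_notMem_tsupport hu0) hγ0]
    simp only [hD, Prod.fst_swap, Prod.snd_swap, norm_sub_rev z.2 z.1]
    ring
  have hs : Integrable (fun z : V × V => D z.swap) (volume.prod volume) := hi.swap
  have hED : Integrable (fun z : V × V =>
      (u z.1 - u z.2) ^ 2 * Real.exp (-(b * ‖z.1 - z.2‖ ^ 2)) - D z) (volume.prod volume) :=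
    hE.sub hi
  rw [hfun]
  refine ⟨hED.sub hs, ?_⟩
  rw [integral_sub hED hs, integral_sub hE hi, integral_prod_swap D, he]
  ring

theorem integral_rpow_mul_integral_mul_gaussianIncrement [Nontrivial V] {u : V → ℝ}
    (hu : Continuous u) (hc : HasCompactSupport u) (hu0 : (0 : V) ∉ tsupport u) {s γ : ℝ}
    (hs : 0 < s) (hs1 : s < 1) (hγ0 : γ ≠ 0) (hγs : γ < 2 * s)
    (hγ : 2 * s < Module.finrank ℝ V + γ) :
    Integrable (fun b : ℝ => b ^ ((Module.finrank ℝ V : ℝ) / 2 + s - 1) *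
      ∫ x, u x ^ 2 * ‖x‖ ^ (-γ) * gaussianIncrement γ b x) (volume.restrict (Ioi (0 : ℝ))) ∧
    ∫ b in Ioi (0 : ℝ), b ^ ((Module.finrank ℝ V : ℝ) / 2 + s - 1) *
      ∫ x, u x ^ 2 * ‖x‖ ^ (-γ) * gaussianIncrement γ b x =
      Real.pi ^ ((Module.finrank ℝ V : ℝ) / 2) * Real.Gamma ((2 * s - γ) / 2) *
          Real.Gamma ((Module.finrank ℝ V + γ) / 2) * Real.Gamma (1 - s) /
          (s * Real.Gamma (-γ / 2) * Real.Gamma ((Module.finrank ℝ V + γ - 2 * s) / 2)) *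
        ∫ x, u x ^ 2 * ‖x‖ ^ (-(2 * s)) := by
  obtain ⟨c, h⟩ := integral_rpow_mul_gaussianIncrement (V := V) hs hs1 hγ0 hγs hγ
  set h' : ℝ := ((Module.finrank ℝ V : ℕ) : ℝ) / 2 + s - 1 with hh
  generalize Real.pi ^ ((Module.finrank ℝ V : ℝ) / 2) * Real.Gamma ((2 * s - γ) / 2) *
    Real.Gamma ((Module.finrank ℝ V + γ) / 2) * Real.Gamma (1 - s) /
    (s * Real.Gamma (-γ / 2) * Real.Gamma ((Module.finrank ℝ V + γ - 2 * s) / 2)) = k at h ⊢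
  have hz : u 0 = 0 := image_eq_zero_of_notMem_tsupport hu0
  have hm := hu.measurable
  have hpow : ∀ x : V, x ≠ 0 → ‖x‖ ^ (-γ) * ‖x‖ ^ (γ - 2 * s) = ‖x‖ ^ (-(2 * s)) := fun x hx => by
    rw [← Real.rpow_add (norm_pos_iff.2 hx)]; ring_nf
  have hI : Integrable (fun x => u x ^ 2 * ‖x‖ ^ (-(2 * s))) := by
    simpa using integrable_sq_mul_norm_rpow hu hc hu0 (-(2 * s)) 0
  have hG : StronglyMeasurable (fun p : V × ℝ => gaussianIncrement γ p.2 p.1) := by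
    refine StronglyMeasurable.integral_prod_right (f := fun (p : V × ℝ) (y : V) =>
      (‖p.1‖ ^ γ - ‖y‖ ^ γ) * Real.exp (-(p.2 * ‖p.1 - y‖ ^ 2))) ?_
    exact (by fun_prop : Measurable fun q : (V × ℝ) × V =>
      (‖q.1.1‖ ^ γ - ‖q.2‖ ^ γ) * Real.exp (-(q.1.2 * ‖q.1.1 - q.2‖ ^ 2))).stronglyMeasurable
  have hGm := hG.measurable
  have hmf : StronglyMeasurable (fun p : V × ℝ =>
      u p.1 ^ 2 * ‖p.1‖ ^ (-γ) * (p.2 ^ h' * gaussianIncrement γ p.2 p.1)) :=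
    (by fun_prop : Measurable fun p : V × ℝ =>
      u p.1 ^ 2 * ‖p.1‖ ^ (-γ) * (p.2 ^ h' * gaussianIncrement γ p.2 p.1)).stronglyMeasurable
  have hi : Integrable (fun p : V × ℝ =>
      u p.1 ^ 2 * ‖p.1‖ ^ (-γ) * (p.2 ^ h' * gaussianIncrement γ p.2 p.1))
      ((volume : Measure V).prod (volume.restrict (Ioi (0 : ℝ)))) := by
    refine (integrable_prod_iff hmf.aestronglyMeasurable).2 ⟨?_, ?_⟩
    · filter_upwards with x
      by_cases hx : x = 0
      · simp [hx, hz]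
      · exact (h x hx).1.const_mul _
    · refine (hI.const_mul c).mono' hmf.norm.integral_prod_right.aestronglyMeasurable ?_
      filter_upwards with x
      rw [Real.norm_of_nonneg (integral_nonneg fun _ => norm_nonneg _)]
      by_cases hx : x = 0
      · simp [hx, hz]
      · simp only [norm_mul _ (_ * gaussianIncrement _ _ _), Real.norm_eq_abs]
        rw [integral_const_mul, abs_of_nonneg (by positivity)]
        refine (mul_le_mul_of_nonneg_left (h x hx).2.2 (by positivity)).trans_eq ?_
        rw [← hpow x hx]
        ring
  have hswap := hi.integral_prod_right
  have e : ∀ b : ℝ, ∫ x, u x ^ 2 * ‖x‖ ^ (-γ) * (b ^ h' * gaussianIncrement γ b x) =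
      b ^ h' * ∫ x, u x ^ 2 * ‖x‖ ^ (-γ) * gaussianIncrement γ b x := fun b => by
    rw [← integral_const_mul]
    congr 1 with x
    ring
  simp only [e] at hswap
  refine ⟨hswap, ?_⟩
  simp only [← e]
  rw [← integral_prod_symm _ hi, integral_prod _ hi, ← integral_const_mul]
  congr 1 with x
  by_cases hx : x = 0
  · simp [hx, hz]
  · simp only []
    rw [integral_const_mul, (h x hx).2.1, ← hpow x hx]
    ring

theorem Gamma_mul_integral_weighted_sq_sub [Nontrivial V] {u : V → ℝ} {L : NNReal}
    (hL : LipschitzWith L u) (hc : HasCompactSupport u) (hu0 : (0 : V) ∉ tsupport u) {s γ : ℝ}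
    (hs : 0 < s) (hs1 : s < 1) (hγ0 : γ ≠ 0) (hγs : γ < 2 * s)
    (hγ : 2 * s < Module.finrank ℝ V + γ) :
    Real.Gamma ((Module.finrank ℝ V + 2 * s) / 2) *
      ∫ x : V, ∫ y : V, (‖x‖ ^ (-γ) * u x - ‖y‖ ^ (-γ) * u y) ^ 2 *
        ‖x - y‖ ^ (-((Module.finrank ℝ V : ℝ) + 2 * s)) * ‖y‖ ^ γ * ‖x‖ ^ γ =
    Real.Gamma ((Module.finrank ℝ V + 2 * s) / 2) *
      (∫ x : V, ∫ y : V, (u x - u y) ^ 2 * ‖x - y‖ ^ (-((Module.finrank ℝ V : ℝ) + 2 * s))) -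
    2 * (Real.pi ^ ((Module.finrank ℝ V : ℝ) / 2) * Real.Gamma ((2 * s - γ) / 2) *
          Real.Gamma ((Module.finrank ℝ V + γ) / 2) * Real.Gamma (1 - s) /
          (s * Real.Gamma (-γ / 2) * Real.Gamma ((Module.finrank ℝ V + γ - 2 * s) / 2)) *
        ∫ x, u x ^ 2 * ‖x‖ ^ (-(2 * s))) := by
  have hu := hL.continuous
  have hm := hu.measurable
  have hγ' : 0 < Module.finrank ℝ V + γ := by linarith
  obtain ⟨hg1, hg2⟩ :=
    integral_rpow_mul_integral_mul_gaussianIncrement hu hc hu0 hs hs1 hγ0 hγs hγ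
  have hE1 := integrable_rpow_mul_integral_sq_sub_mul_exp hL hc hs hs1
  obtain ⟨hE2, hE3⟩ := integrable_mul_norm_sub_rpow_of_gaussian
    (A := fun z : V × V => (u z.1 - u z.2) ^ 2) (by fun_prop) (fun z => by positivity)
    (fun x => by simp) hs (fun b hb => (integrable_sq_sub_mul_exp hu hc hb).1) hE1
  have hF0 : ∀ b ∈ Ioi (0 : ℝ), b ^ ((Module.finrank ℝ V : ℝ) / 2 + s - 1) *
      ∫ z : V × V, (‖z.1‖ ^ (-γ) * u z.1 - ‖z.2‖ ^ (-γ) * u z.2) ^ 2 * ‖z.2‖ ^ γ * ‖z.1‖ ^ γ *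
        Real.exp (-(b * ‖z.1 - z.2‖ ^ 2)) ∂(volume.prod volume) =
      b ^ ((Module.finrank ℝ V : ℝ) / 2 + s - 1) *
        (∫ z : V × V, (u z.1 - u z.2) ^ 2 * Real.exp (-(b * ‖z.1 - z.2‖ ^ 2))
          ∂(volume.prod volume)) -
      2 * (b ^ ((Module.finrank ℝ V : ℝ) / 2 + s - 1) *
        ∫ x, u x ^ 2 * ‖x‖ ^ (-γ) * gaussianIncrement γ b x) := fun b hb => by
    rw [(integral_weighted_sq_sub_mul_exp hu hc hu0 hγ0 hγ' hb).2]
    ring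
  have hF1 : Integrable (fun b : ℝ => b ^ ((Module.finrank ℝ V : ℝ) / 2 + s - 1) *
      ∫ z : V × V, (‖z.1‖ ^ (-γ) * u z.1 - ‖z.2‖ ^ (-γ) * u z.2) ^ 2 * ‖z.2‖ ^ γ * ‖z.1‖ ^ γ *
        Real.exp (-(b * ‖z.1 - z.2‖ ^ 2)) ∂(volume.prod volume))
      (volume.restrict (Ioi (0 : ℝ))) := by
    refine (hE1.sub (hg1.const_mul 2)).congr ?_
    filter_upwards [ae_restrict_mem measurableSet_Ioi] with b hb
    exact (hF0 b hb).symm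
  obtain ⟨hF2, hF3⟩ := integrable_mul_norm_sub_rpow_of_gaussian
    (A := fun z : V × V =>
      (‖z.1‖ ^ (-γ) * u z.1 - ‖z.2‖ ^ (-γ) * u z.2) ^ 2 * ‖z.2‖ ^ γ * ‖z.1‖ ^ γ)
    (by fun_prop) (fun z => by positivity) (fun x => by simp) hs
    (fun b hb => (integral_weighted_sq_sub_mul_exp hu hc hu0 hγ0 hγ' hb).1) hF1
  rw [setIntegral_congr_fun measurableSet_Ioi hF0, integral_sub hE1 (hg1.const_mul 2),
    integral_const_mul, hg2, ← hE3, integral_prod _ hE2, integral_prod _ hF2] at hF3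
  rw [← hF3]
  congr 1
  refine integral_congr_ae (Filter.Eventually.of_forall fun x => ?_)
  refine integral_congr_ae (Filter.Eventually.of_forall fun y => ?_)
  simp only []
  ring

end GroundState

/-- Ground-state transformation identity: for `u ∈ C_0^∞(Ω \ {0})` and
`v = |x|^{-γ} u`, with `μ ≥ μ₀` the Hardy parameter corresponding to `γ`
(i.e. `τ₊(s,μ) = γ`, encoded through the explicit Gamma-function formula
`μ = -2^{2s} Γ((2s-γ)/2) Γ((N+γ)/2) / (Γ(-γ/2) Γ((N+γ-2s)/2))`), one has
`(C_{N,s}/2) [u]² + μ ∫ u²|x|^{-2s} = (C_{N,s}/2) [v]²_{γ}`. -/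
theorem ground_state_identity (N : ℕ) (hN : 2 ≤ N) (s γ μ : ℝ)
    (hs : s ∈ Set.Ioo (0 : ℝ) 1)
    (Ω : Set (EuclideanSpace ℝ (Fin N))) (hΩopen : IsOpen Ω)
    (hΩbd : Bornology.IsBounded Ω) (h0 : (0 : EuclideanSpace ℝ (Fin N)) ∈ Ω)
    (hγ : γ ∈ Set.Ico ((2 * s - N) / 2) (2 * s))
    (hμ0 : -(2 ^ (2 * s)) * Real.Gamma ((N + 2 * s) / 4) ^ 2 /
        Real.Gamma ((N - 2 * s) / 4) ^ 2 ≤ μ)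
    (hμγ : μ = -(2 ^ (2 * s) * Real.Gamma ((2 * s - γ) / 2) * Real.Gamma ((N + γ) / 2) /
        (Real.Gamma (-γ / 2) * Real.Gamma ((N + γ - 2 * s) / 2))))
    (u : EuclideanSpace ℝ (Fin N) → ℝ) (hu : ContDiff ℝ (⊤ : ℕ∞) u)
    (husupp : HasCompactSupport u) (husupp' : tsupport u ⊆ Ω \ {0})
    (v : EuclideanSpace ℝ (Fin N) → ℝ) (hv : ∀ x, v x = ‖x‖ ^ (-γ) * u x) :
    (2 ^ (2 * s) * Real.pi ^ (-(N : ℝ) / 2) * s * Real.Gamma ((N + 2 * s) / 2) /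
        Real.Gamma (1 - s)) / 2 *
      (∫ x, ∫ y, (u x - u y) ^ 2 * ‖x - y‖ ^ (-((N : ℝ) + 2 * s))) +
      μ * ∫ x, (u x) ^ 2 * ‖x‖ ^ (-(2 * s)) =
    (2 ^ (2 * s) * Real.pi ^ (-(N : ℝ) / 2) * s * Real.Gamma ((N + 2 * s) / 2) /
        Real.Gamma (1 - s)) / 2 *
      (∫ x, ∫ y, (v x - v y) ^ 2 * ‖x - y‖ ^ (-((N : ℝ) + 2 * s)) * ‖y‖ ^ γ * ‖x‖ ^ γ) := by
  obtain ⟨hs0, hs1⟩ := hs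
  obtain ⟨hγ1, hγ2⟩ := hγ
  have hN' : (2 : ℝ) ≤ N := by exact_mod_cast hN
  obtain rfl : v = fun x => ‖x‖ ^ (-γ) * u x := funext hv
  by_cases hγ0 : γ = 0
  · subst hγ0
    have hμ : μ = 0 := by rw [hμγ]; simp [Real.Gamma_zero]
    simp [hμ]
  have : Nontrivial (EuclideanSpace ℝ (Fin N)) := by
    apply Module.nontrivial_of_finrank_pos (R := ℝ)
    rw [finrank_euclideanSpace_fin]
    omega
  obtain ⟨L, hL⟩ := ContDiff.lipschitzWith_of_hasCompactSupport husupp hu (by simp)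
  have h00 : (0 : EuclideanSpace ℝ (Fin N)) ∉ tsupport u := fun h => (husupp' h).2 rfl
  have key := Gamma_mul_integral_weighted_sq_sub hL husupp h00 hs0 hs1 hγ0 hγ2
    (by rw [finrank_euclideanSpace_fin]; linarith)
  rw [finrank_euclideanSpace_fin] at key
  have hG1 : Real.Gamma (1 - s) ≠ 0 := (Real.Gamma_pos_of_pos (by linarith)).ne'
  have hG2 : Real.Gamma (-γ / 2) ≠ 0 := Gamma_neg_half_ne_zero hγ0 (by linarith)
  have hG3 : Real.Gamma ((N + γ - 2 * s) / 2) ≠ 0 :=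
    (Real.Gamma_pos_of_pos (by linarith)).ne'
  have hπ : Real.pi ^ (-(N : ℝ) / 2) = (Real.pi ^ ((N : ℝ) / 2))⁻¹ := by
    rw [neg_div, Real.rpow_neg Real.pi_pos.le]
  have hπ0 : Real.pi ^ ((N : ℝ) / 2) ≠ 0 := (Real.rpow_pos_of_pos Real.pi_pos _).ne'
  rw [hμγ, hπ]
  generalize Real.pi ^ ((N : ℝ) / 2) = p at *
  generalize Real.Gamma (1 - s) = G1 at *
  generalize Real.Gamma (-γ / 2) = G2 at *
  generalize Real.Gamma ((N + γ - 2 * s) / 2) = G3 at *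
  generalize Real.Gamma ((N + 2 * s) / 2) = G at *
  generalize (2 : ℝ) ^ (2 * s) = t at *
  simp only [] at key ⊢
  have hs' := hs0.ne'
  trans t * p⁻¹ * s / G1 / 2 * (G * ∫ x, ∫ y, (‖x‖ ^ (-γ) * u x - ‖y‖ ^ (-γ) * u y) ^ 2 *
    ‖x - y‖ ^ (-((N : ℝ) + 2 * s)) * ‖y‖ ^ γ * ‖x‖ ^ γ)
  · rw [key]
    field_simp
    ring
  · ring
end
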